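/- arXiv:2005.03397 — 4 statements merged into one kernel-verified Lean document; each statement's English description precedes it below -/
import Mathlib

section
/- Let n ≥ 1 and let W be the heat kernel on ℝ^{n+1}. There is a constant C depending only on n such that for every x̄ = (x,t) ∈ ℝ^{n+1} with x ≠ 0 one has |∂_t^{1/2} W(x̄)| ≤ C / (|x|^{n-1} |x̄|_p²), where ∂_t^{1/2} W(x,t) = ∫_ℝ (W(x,s) − W(x,t))/|s−t|^{3/2} ds. -/
open MeasureTheory Real Set

noncomputable section

/-- The spatial factor `ℝⁿ`. -/
abbrev Spc (n : ℕ) := EuclideanSpace ℝ (Fin n)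

/-- The parabolic space `ℝ^{n+1} = ℝⁿ × ℝ`, points `x̄ = (x, t)`. -/
abbrev Pt (n : ℕ) := Spc n × ℝ

/-- The parabolic norm `|x̄|_p = max (|x|, |t|^{1/2})`. -/
def pnorm {n : ℕ} (p : Pt n) : ℝ := max ‖p.1‖ (Real.sqrt |p.2|)

/-- The parabolic ball of center `c` and radius `r`. -/
def pball {n : ℕ} (c : Pt n) (r : ℝ) : Set (Pt n) := {p | pnorm (p - c) < r}

/-- The heat kernel `W`. -/
def heatW {n : ℕ} (p : Pt n) : ℝ :=
  if 0 < p.2 then (4 * π * p.2) ^ (-(n : ℝ) / 2) * Real.exp (-‖p.1‖ ^ 2 / (4 * p.2)) else 0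

/-- The spatial gradient `∇ₓ W` of the heat kernel. -/
def gradW {n : ℕ} (p : Pt n) : Spc n :=
  if 0 < p.2 then
    (-(1 / (2 * p.2)) * (4 * π * p.2) ^ (-(n : ℝ) / 2) * Real.exp (-‖p.1‖ ^ 2 / (4 * p.2))) • p.1
  else 0

/-- Half time derivative `∂_t^{1/2} f (x,t) = ∫ (f(x,s) - f(x,t))/|s-t|^{3/2} ds`. -/
def halfT {n : ℕ} (f : Pt n → ℝ) (p : Pt n) : ℝ :=
  ∫ s : ℝ, (f (p.1, s) - f p) / |s - p.2| ^ (3 / 2 : ℝ)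

/-- A parabolic cube: product of `n` intervals of length `len` and a time interval
of length `len ^ 2`. -/
structure PCube (n : ℕ) where
  corner : Fin n → ℝ
  time : ℝ
  len : ℝ
  len_pos : 0 < len

/-- The set of points of a parabolic cube. -/
def PCube.toSet {n : ℕ} (Q : PCube n) : Set (Pt n) :=
  {p | (∀ i, p.1 i ∈ Set.Icc (Q.corner i) (Q.corner i + Q.len)) ∧
    p.2 ∈ Set.Icc Q.time (Q.time + Q.len ^ 2)}

/-- The dilation `λQ` of a parabolic cube: same center, side lengths `λ·len` and
`λ²·len²`. -/
def PCube.dilate {n : ℕ} (Q : PCube n) (lam : ℝ) (h : 0 < lam) : PCube n :=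
  ⟨fun i => Q.corner i + Q.len / 2 - lam * Q.len / 2,
    Q.time + Q.len ^ 2 / 2 - lam ^ 2 * Q.len ^ 2 / 2,
    lam * Q.len, mul_pos h Q.len_pos⟩

/-- Second directional derivative in the `i`-th spatial direction. -/
def dir2 {n : ℕ} (φ : Pt n → ℝ) (p : Pt n) (i : Fin n) : ℝ :=
  deriv (fun h : ℝ =>
    deriv (fun h' : ℝ => φ (p.1 + h' • (EuclideanSpace.single i 1 : Spc n), p.2)) h) 0

/-- Spatial Laplacian `Δₓ φ`. -/
def lapx {n : ℕ} (φ : Pt n → ℝ) (p : Pt n) : ℝ := ∑ i : Fin n, dir2 φ p i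

/-- A `C²` function `φ` is admissible for a parabolic cube `Q` if it is supported on `Q`,
`‖∇ₓ φ‖_∞ ≤ 1/ℓ(Q)` and `‖Δₓ φ‖_∞ + ‖∂_t φ‖_∞ ≤ 1/ℓ(Q)²`. -/
def Admissible {n : ℕ} (φ : Pt n → ℝ) (Q : PCube n) : Prop :=
  ContDiff ℝ 2 φ ∧ tsupport φ ⊆ Q.toSet ∧
  (∀ p : Pt n, ‖fderiv ℝ (fun y : Spc n => φ (y, p.2)) p.1‖ ≤ 1 / Q.len) ∧
  (∀ p : Pt n, |lapx φ p| + |deriv (fun s : ℝ => φ (p.1, s)) p.2| ≤ 1 / Q.len ^ 2)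

/-- The parabolic BMO norm of `f` is at most `C`. -/
def ParabBMOLe {n : ℕ} (f : Pt n → ℝ) (C : ℝ) : Prop :=
  ∀ Q : PCube n, ⨍ p in Q.toSet, |f p - ⨍ q in Q.toSet, f q| ≤ C

/-- `‖F‖_{Lip_{1/2,t}} ≤ C` : half-Lipschitz in time. -/
def LipHalfLe {n : ℕ} (F : Pt n → ℝ) (C : ℝ) : Prop :=
  ∀ (x : Spc n) (t u : ℝ), |F (x, t) - F (x, u)| ≤ C * Real.sqrt |t - u|

/-- Integral of a scalar function against a finite signed measure. -/
def sInt {n : ℕ} (ν : SignedMeasure (Pt n)) (f : Pt n → ℝ) : ℝ :=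
  ∫ y, f y ∂ν.toJordanDecomposition.posPart - ∫ y, f y ∂ν.toJordanDecomposition.negPart

/-- Integral of a vector-valued function against a finite signed measure. -/
def vInt {n : ℕ} (ν : SignedMeasure (Pt n)) (f : Pt n → Spc n) : Spc n :=
  ∫ y, f y ∂ν.toJordanDecomposition.posPart - ∫ y, f y ∂ν.toJordanDecomposition.negPart

/-- `W * ν`. -/
def convW {n : ℕ} (ν : SignedMeasure (Pt n)) (p : Pt n) : ℝ :=
  sInt ν (fun y => heatW (p - y))

/-- `∇ₓ W * ν`. -/
def convGradW {n : ℕ} (ν : SignedMeasure (Pt n)) (p : Pt n) : Spc n :=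
  vInt ν (fun y => gradW (p - y))

/-- `W * (φ ν)`, where `φν` is the measure with density `φ` w.r.t. `ν`. -/
def convWd {n : ℕ} (ν : SignedMeasure (Pt n)) (φ : Pt n → ℝ) (p : Pt n) : ℝ :=
  sInt ν (fun y => φ y * heatW (p - y))

/-- `∇ₓ W * (φ ν)`. -/
def convGradWd {n : ℕ} (ν : SignedMeasure (Pt n)) (φ : Pt n → ℝ) (p : Pt n) : Spc n :=
  vInt ν (fun y => φ y • gradW (p - y))

/-- `W * μ` for a positive measure `μ`. -/
def mconvW {n : ℕ} (μ : Measure (Pt n)) (p : Pt n) : ℝ := ∫ y, heatW (p - y) ∂μ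

/-- `∇ₓ W * μ` for a positive measure `μ`. -/
def mconvGradW {n : ℕ} (μ : Measure (Pt n)) (p : Pt n) : Spc n := ∫ y, gradW (p - y) ∂μ

/-- Upper parabolic growth of degree `n+1` with constant `1`. -/
def PGrowth {n : ℕ} (μ : Measure (Pt n)) : Prop :=
  ∀ (c : Pt n) (r : ℝ), 0 < r → μ (pball c r) ≤ ENNReal.ofReal (r ^ (n + 1))

def nearK (a u : ℝ) : ℝ := if |u| ≤ a then |u| ^ (-(1/2) : ℝ) else 0
def farK (a u : ℝ) : ℝ := if a < |u| then |u| ^ (-(3/2) : ℝ) else 0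

lemma near_aux (a : ℝ) (ha : 0 < a) :
    IntegrableOn (fun x : ℝ => if x ≤ a then x ^ (-(1/2) : ℝ) else 0) (Ioi 0) ∧
    ∫ x in Ioi (0:ℝ), (if x ≤ a then x ^ (-(1/2) : ℝ) else 0) = 2 * √a := by
  have h : (fun x : ℝ => if x ≤ a then x ^ (-(1/2) : ℝ) else 0)
      = (Iic a).indicator (fun x => x ^ (-(1/2) : ℝ)) := by
    ext x; simp [indicator]
  rw [h]
  have hI : IntegrableOn (fun x : ℝ => x ^ (-(1/2) : ℝ)) (Ioc 0 a) := by
    have := intervalIntegral.intervalIntegrable_rpow' (a := 0) (b := a) (r := -(1/2)) (by norm_num)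
    rwa [intervalIntegrable_iff_integrableOn_Ioc_of_le ha.le] at this
  have hs : Ioi 0 ∩ Iic a = Ioc 0 a := rfl
  constructor
  · rw [integrableOn_indicator_iff measurableSet_Iic, inter_comm, hs]
    exact hI
  · rw [setIntegral_indicator measurableSet_Iic, hs, ← intervalIntegral.integral_of_le ha.le,
      integral_rpow (Or.inl (by norm_num))]
    rw [Real.sqrt_eq_rpow]
    norm_num
    ring

lemma far_aux (a : ℝ) (ha : 0 < a) :
    IntegrableOn (fun x : ℝ => if a < x then x ^ (-(3/2) : ℝ) else 0) (Ioi 0) ∧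
    ∫ x in Ioi (0:ℝ), (if a < x then x ^ (-(3/2) : ℝ) else 0) = 2 / √a := by
  have h : (fun x : ℝ => if a < x then x ^ (-(3/2) : ℝ) else 0)
      = (Ioi a).indicator (fun x => x ^ (-(3/2) : ℝ)) := by
    ext x; simp [indicator]
  rw [h]
  have hs : Ioi 0 ∩ Ioi a = Ioi a := by
    rw [Ioi_inter_Ioi]; simp [ha.le]
  constructor
  · rw [integrableOn_indicator_iff measurableSet_Ioi, inter_comm, hs]
    exact integrableOn_Ioi_rpow_of_lt (by norm_num) ha
  · rw [setIntegral_indicator measurableSet_Ioi, hs, integral_Ioi_rpow_of_lt (by norm_num) ha]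
    rw [Real.sqrt_eq_rpow, show (-(3/2) + 1 : ℝ) = -(1/2) by norm_num, rpow_neg ha.le]
    field_simp

lemma int_abs {f : ℝ → ℝ} (hf : IntegrableOn f (Ioi 0)) : Integrable (fun x : ℝ => f |x|) := by
  have h1 : IntegrableOn (fun x : ℝ => f |x|) (Ioi 0) :=
    hf.congr_fun (fun x hx => by rw [abs_of_pos (by exact hx)]) measurableSet_Ioi
  have h2 : IntegrableOn (fun x : ℝ => f |x|) (Iic 0) := by
    rw [← Measure.map_neg_eq_self (volume : Measure ℝ)]
    let m : MeasurableEmbedding fun x : ℝ => -x := (Homeomorph.neg ℝ).measurableEmbedding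
    rw [m.integrableOn_map_iff]
    simp_rw [Function.comp_def, abs_neg, neg_preimage, neg_Iic, neg_zero]
    exact Iff.mpr integrableOn_Ici_iff_integrableOn_Ioi h1
  have := h2.union h1
  rwa [Iic_union_Ioi, integrableOn_univ] at this

lemma nearK_int (a : ℝ) (ha : 0 < a) : Integrable (nearK a) ∧ ∫ u, nearK a u = 4 * √a := by
  obtain ⟨h1, h2⟩ := near_aux a ha
  refine ⟨int_abs (f := fun x : ℝ => if x ≤ a then x ^ (-(1/2) : ℝ) else 0) h1, ?_⟩
  have := integral_comp_abs (f := fun x : ℝ => if x ≤ a then x ^ (-(1/2) : ℝ) else 0)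
  rw [h2] at this
  unfold nearK
  rw [this]; ring

lemma farK_int (a : ℝ) (ha : 0 < a) : Integrable (farK a) ∧ ∫ u, farK a u = 4 / √a := by
  obtain ⟨h1, h2⟩ := far_aux a ha
  refine ⟨int_abs (f := fun x : ℝ => if a < x then x ^ (-(3/2) : ℝ) else 0) h1, ?_⟩
  have := integral_comp_abs (f := fun x : ℝ => if a < x then x ^ (-(3/2) : ℝ) else 0)
  rw [h2] at this
  unfold farK
  rw [this]; ring

lemma core (h : ℝ → ℝ) (t a b A B D : ℝ) (ha : 0 < a) (hb : 0 < b)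
    (hbd : ∀ s, |h s| ≤ A * nearK a (s - t) + B * farK a (s - t) + D * nearK b s) :
    |∫ s, h s| ≤ A * (4 * √a) + B * (4 / √a) + D * (4 * √b) := by
  obtain ⟨h1, h2⟩ := nearK_int a ha
  obtain ⟨h3, h4⟩ := farK_int a ha
  obtain ⟨h5, h6⟩ := nearK_int b hb
  have i1 : Integrable (fun s => A * nearK a (s - t)) := (h1.comp_sub_right t).const_mul A
  have i2 : Integrable (fun s => B * farK a (s - t)) := (h3.comp_sub_right t).const_mul B
  have i3 : Integrable (fun s => D * nearK b s) := h5.const_mul D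
  have i12 : Integrable (fun s => A * nearK a (s - t) + B * farK a (s - t)) := i1.add i2
  have := norm_integral_le_of_norm_le (f := h) (i12.add i3) (Filter.Eventually.of_forall hbd)
  simp only [Pi.add_apply] at this
  rw [integral_add i12 i3, integral_add i1 i2, integral_const_mul, integral_const_mul,
    integral_const_mul, integral_sub_right_eq_self (nearK a), integral_sub_right_eq_self (farK a),
    h2, h4, h6] at this
  exact this

lemma exp_bd (k : ℝ) (hk : 0 ≤ k) : ∃ C : ℝ, 0 < C ∧ ∀ s : ℝ, 0 < s →
    s ^ (-k) * exp (-1 / (4 * s)) ≤ C := by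
  refine ⟨(4 * (k + 1)) ^ k, by positivity, fun s hs => ?_⟩
  set y := 1 / (4 * s) with hy
  have hy0 : 0 < y := by positivity
  have e1 : s⁻¹ ≤ 4 * (k + 1) * exp (y / (k + 1)) := by
    have := Real.add_one_le_exp (y / (k + 1))
    have h2 : s⁻¹ = 4 * (k + 1) * (y / (k + 1)) := by rw [hy]; field_simp
    rw [h2]
    gcongr
    linarith
  have e2 : s ^ (-k) ≤ (4 * (k + 1)) ^ k * exp y := by
    rw [rpow_neg hs.le, ← inv_rpow hs.le]
    calc (s⁻¹) ^ k ≤ (4 * (k + 1) * exp (y / (k + 1))) ^ k := by gcongr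
      _ = (4 * (k + 1)) ^ k * exp (y / (k + 1) * k) := by
        rw [mul_rpow (by positivity) (by positivity), ← exp_mul]
      _ ≤ _ := by
        gcongr
        rw [div_mul_eq_mul_div, div_le_iff₀ (by positivity)]
        nlinarith
  have e3 : -1 / (4 * s) = - y := by rw [hy]; ring
  rw [e3]
  calc s ^ (-k) * exp (-y) ≤ (4 * (k + 1)) ^ k * exp y * exp (-y) := by gcongr
    _ = _ := by rw [mul_assoc, ← exp_add]; simp

def FF (n : ℕ) (s : ℝ) : ℝ :=
  if 0 < s then (4 * π * s) ^ (-(n : ℝ) / 2) * exp (-1 / (4 * s)) else 0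

lemma FF_pos (n : ℕ) {s : ℝ} (hs : 0 < s) :
    FF n s = (4 * π) ^ (-(n : ℝ) / 2) * (s ^ (-((n : ℝ) / 2)) * exp (-1 / (4 * s))) := by
  rw [FF, if_pos hs, mul_rpow (by positivity) hs.le, neg_div, mul_assoc]

lemma FF_np (n : ℕ) {s : ℝ} (hs : s ≤ 0) : FF n s = 0 := by
  rw [FF, if_neg (not_lt.2 hs)]

lemma FF_nonneg (n : ℕ) (s : ℝ) : 0 ≤ FF n s := by
  unfold FF; split_ifs <;> positivity

lemma rpow_half {s : ℝ} (hs : 0 < s) : s ^ (-(1/2) : ℝ) = 1 / √s := by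
  rw [rpow_neg hs.le, ← sqrt_eq_rpow, one_div]

lemma rpow_three_half {s : ℝ} (hs : 0 ≤ s) : s ^ (3/2 : ℝ) = s * √s := by
  rcases hs.eq_or_lt with rfl | hs
  · norm_num
  rw [sqrt_eq_rpow, show (3/2:ℝ) = 1 + 1/2 by norm_num, rpow_add hs, rpow_one]

lemma FF_deriv (n : ℕ) (hn : 1 ≤ n) : ∃ K : ℝ, 0 < K ∧ ∀ s : ℝ, 0 < s →
    ∃ d, HasDerivAt (FF n) d s ∧ |d| ≤ K ∧ |d| ≤ K / (s * √s) := by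
  have hn' : (1:ℝ) ≤ n := by exact_mod_cast hn
  obtain ⟨C1, h1, b1⟩ := exp_bd ((n:ℝ)/2 + 1) (by positivity)
  obtain ⟨C2, h2, b2⟩ := exp_bd ((n:ℝ)/2 + 2) (by positivity)
  obtain ⟨C3, h3, b3⟩ := exp_bd (((n:ℝ)-1)/2) (by linarith)
  obtain ⟨C4, h4, b4⟩ := exp_bd (((n:ℝ)+1)/2) (by linarith)
  set P : ℝ := (4 * π) ^ (-(n : ℝ) / 2) with hP
  have hP0 : 0 < P := by positivity
  refine ⟨P * (n/2 * (C1 + C3) + (C2 + C4)), by positivity, fun s hs => ?_⟩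
  set E := exp (-1 / (4 * s)) with hE
  have hE0 : 0 < E := exp_pos _
  have hd : HasDerivAt (fun s : ℝ => P * (s ^ (-((n : ℝ) / 2)) * exp (-1 / (4 * s))))
      (P * (-(n/2) * s ^ (-((n:ℝ)/2 + 1)) * E + s ^ (-((n:ℝ)/2)) * (E * (1 / (4 * s^2))))) s := by
    have a1 := Real.hasDerivAt_rpow_const (x := s) (p := -((n:ℝ)/2)) (Or.inl hs.ne')
    have a2 : HasDerivAt (fun s : ℝ => -1 / (4 * s)) (1 / (4 * s^2)) s := by
      have e : (fun s : ℝ => -1 / (4 * s)) = fun s : ℝ => (-1) * (4 * s)⁻¹ := by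
        ext u; rw [div_eq_mul_inv]
      rw [e]
      have := ((hasDerivAt_id' s).const_mul 4).fun_inv (by simpa using hs.ne') |>.const_mul (-1)
      refine this.congr_deriv ?_
      field_simp
    have := (a1.mul a2.exp).const_mul P
    rw [show -((n:ℝ)/2 + 1) = -((n:ℝ)/2) - 1 by ring]
    exact this
  have hd' := hd.congr_of_eventuallyEq (f₁ := FF n)
    (by filter_upwards [lt_mem_nhds hs] with u hu using FF_pos n hu)
  refine ⟨_, hd', ?_⟩
  have q2 : s ^ (-((n:ℝ)/2)) * (E * (1 / (4 * s^2))) = 1/4 * (s ^ (-((n:ℝ)/2 + 2)) * E) := by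
    rw [show -((n:ℝ)/2+2) = -((n:ℝ)/2) - (2:ℕ) by push_cast; ring, rpow_sub_natCast hs.ne']
    field_simp
  rw [q2]
  have hX : 0 ≤ s ^ (-((n:ℝ)/2 + 1)) * E := by positivity
  have hY : 0 ≤ s ^ (-((n:ℝ)/2 + 2)) * E := by positivity
  have key : |P * (-(n/2) * s ^ (-((n:ℝ)/2 + 1)) * E + 1/4 * (s ^ (-((n:ℝ)/2 + 2)) * E))|
      ≤ P * (n/2 * (s ^ (-((n:ℝ)/2 + 1)) * E) + (s ^ (-((n:ℝ)/2 + 2)) * E)) := by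
    rw [abs_mul, abs_of_pos hP0]
    gcongr
    rw [abs_le]
    have : 0 ≤ n/2 * (s ^ (-((n:ℝ)/2 + 1)) * E) := by positivity
    constructor <;> linarith
  constructor
  · refine key.trans ?_
    have := b1 s hs
    have := b2 s hs
    gcongr <;> linarith
  · refine key.trans ?_
    have z : 0 < s * √s := by positivity
    have r1 : s ^ (-((n:ℝ)/2 + 1)) = s ^ (-(((n:ℝ)-1)/2)) / (s * √s) := by
      rw [← rpow_three_half hs.le, ← rpow_sub hs]; congr 1; ring
    have r2 : s ^ (-((n:ℝ)/2 + 2)) = s ^ (-(((n:ℝ)+1)/2)) / (s * √s) := by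
      rw [← rpow_three_half hs.le, ← rpow_sub hs]; congr 1; ring
    rw [r1, r2]
    have c3 := b3 s hs
    have c4 := b4 s hs
    rw [show P * (n/2 * (s ^ (-(((n:ℝ)-1)/2)) / (s * √s) * E) + (s ^ (-(((n:ℝ)+1)/2)) / (s * √s) * E))
      = P * (n/2 * (s ^ (-(((n:ℝ)-1)/2)) * E) + (s ^ (-(((n:ℝ)+1)/2)) * E)) / (s * √s) by ring]
    gcongr <;> linarith

lemma mvt_aux {f : ℝ → ℝ} {c K : ℝ} (hf : ∀ s, c ≤ s → ∃ d, HasDerivAt f d s ∧ |d| ≤ K)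
    {s t : ℝ} (hs : c ≤ s) (ht : c ≤ t) : |f s - f t| ≤ K * |s - t| := by
  refine (convex_Ici c).norm_image_sub_le_of_norm_deriv_le (f := f) (C := K) ?_ ?_ ht hs
  · intro x hx
    obtain ⟨d, hd, _⟩ := hf x hx
    exact hd.differentiableAt
  · intro x hx
    obtain ⟨d, hd, h⟩ := hf x hx
    rw [hd.deriv]; exact h

lemma FF_props (n : ℕ) (hn : 1 ≤ n) : ∃ K : ℝ, 0 < K ∧ (∀ s, |FF n s| ≤ K) ∧
    (∀ s t, |FF n s - FF n t| ≤ K * |s - t|) ∧ (∀ s, |FF n s| ≤ K * (1 / √|s|)) ∧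
    (∀ t s, t ≠ 0 → |s - t| ≤ |t| / 2 → |FF n s - FF n t| ≤ 4 * K / (|t| * √|t|) * |s - t|) := by
  have hn' : (1:ℝ) ≤ n := by exact_mod_cast hn
  obtain ⟨K0, k0, hd⟩ := FF_deriv n hn
  obtain ⟨C1, h1, b1⟩ := exp_bd ((n:ℝ)/2) (by positivity)
  obtain ⟨C2, h2, b2⟩ := exp_bd ((n:ℝ)/2 + 1) (by positivity)
  obtain ⟨C3, h3, b3⟩ := exp_bd (((n:ℝ)-1)/2) (by linarith)
  set P : ℝ := (4 * π) ^ (-(n : ℝ) / 2) with hP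
  have hP0 : 0 < P := by positivity
  have p1 : 0 < P * C1 := by positivity
  have p2 : 0 < P * C2 := by positivity
  have p3 : 0 < P * C3 := by positivity
  obtain ⟨K, hK⟩ : ∃ K, K = K0 + P * C1 + P * C2 + P * C3 := ⟨_, rfl⟩
  have hKp : 0 < K := by rw [hK]; positivity
  have lin : ∀ t, 0 < t → FF n t ≤ K * t := by
    intro t ht
    rw [FF_pos n ht]
    have : t ^ (-((n:ℝ)/2)) = t ^ (-((n:ℝ)/2+1)) * t := by
      rw [← rpow_add_one ht.ne']; congr 1; ring
    rw [this, show (4 * π) ^ (-(n : ℝ) / 2) * (t ^ (-((n:ℝ)/2+1)) * t * exp (-1 / (4 * t))) =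
      P * (t ^ (-((n:ℝ)/2+1)) * exp (-1 / (4 * t))) * t by rw [hP]; ring]
    have := mul_le_mul_of_nonneg_left (b2 t ht) hP0.le
    gcongr
    linarith
  refine ⟨K, hKp, ?_, ?_, ?_, ?_⟩
  · intro s
    rw [abs_of_nonneg (FF_nonneg n s)]
    rcases le_or_gt s 0 with hs | hs
    · rw [FF_np n hs]; exact hKp.le
    · rw [FF_pos n hs]
      have := mul_le_mul_of_nonneg_left (b1 s hs) hP0.le
      linarith
  · have main : ∀ s t, s ≤ t → |FF n s - FF n t| ≤ K * |s - t| := by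
      intro s t hst
      rcases le_or_gt t 0 with ht | ht
      · rw [FF_np n ht, FF_np n (hst.trans ht)]; simp; positivity
      rcases le_or_gt s 0 with hs | hs
      · rw [FF_np n hs, zero_sub, abs_neg, abs_of_nonneg (FF_nonneg n t), abs_sub_comm,
          abs_of_nonneg (by linarith)]
        refine (lin t ht).trans ?_
        gcongr
        linarith
      · refine mvt_aux (c := s) (fun u hu => ?_) le_rfl hst
        obtain ⟨d, q1, q2, _⟩ := hd u (hs.trans_le hu)
        exact ⟨d, q1, by linarith⟩
    intro s t
    rcases le_total s t with h | h
    · exact main s t h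
    · rw [abs_sub_comm, abs_sub_comm s]; exact main t s h
  · intro s
    rw [abs_of_nonneg (FF_nonneg n s)]
    rcases le_or_gt s 0 with hs | hs
    · rw [FF_np n hs]; positivity
    · rw [FF_pos n hs, abs_of_pos hs, ← rpow_half hs]
      have : s ^ (-((n:ℝ)/2)) = s ^ (-(((n:ℝ)-1)/2)) * s ^ (-(1/2):ℝ) := by
        rw [← rpow_add hs]; congr 1; ring
      rw [this, show (4 * π) ^ (-(n : ℝ) / 2) * (s ^ (-(((n:ℝ)-1)/2)) * s ^ (-(1/2):ℝ) * exp (-1 / (4 * s))) =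
        P * (s ^ (-(((n:ℝ)-1)/2)) * exp (-1 / (4 * s))) * s ^ (-(1/2):ℝ) by rw [hP]; ring]
      have := mul_le_mul_of_nonneg_left (b3 s hs) hP0.le
      gcongr
      linarith
  · intro t s ht hst
    have h' := abs_le.1 hst
    rcases lt_or_gt_of_ne ht with ht | ht
    · rw [abs_of_neg ht] at h'
      rw [FF_np n ht.le, FF_np n (by linarith [h'.2])]; simp; positivity
    · rw [abs_of_pos ht] at h' ⊢
      refine mvt_aux (c := t/2) (fun u hu => ?_) (by linarith [h'.1]) (by linarith)
      have hu0 : 0 < u := by linarith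
      obtain ⟨d, q1, _, q2⟩ := hd u hu0
      refine ⟨d, q1, q2.trans ?_⟩
      have hsq : √t ≤ 2 * √u := by
        rw [Real.sqrt_le_left (by positivity), mul_pow, Real.sq_sqrt hu0.le]; linarith
      rw [div_le_div_iff₀ (by positivity) (by positivity)]
      have : t * √t ≤ (2 * u) * (2 * √u) := by gcongr; linarith
      calc K0 * (t * √t) ≤ K * ((2 * u) * (2 * √u)) := by gcongr; linarith
        _ = _ := by ring

lemma nearK_nonneg (a u : ℝ) : 0 ≤ nearK a u := by
  unfold nearK; split_ifs <;> positivity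

lemma farK_nonneg (a u : ℝ) : 0 ≤ farK a u := by
  unfold farK; split_ifs <;> positivity

lemma farK_of {a u : ℝ} (ha : 0 < a) (h : a < |u|) : farK a u = 1 / (|u| * √|u|) := by
  rw [farK, if_pos h, rpow_neg (abs_nonneg _), rpow_three_half (abs_nonneg _), one_div]

lemma nearK_of {a u : ℝ} (hu : u ≠ 0) (h : |u| ≤ a) : nearK a u = 1 / √|u| := by
  rw [nearK, if_pos h, rpow_half (abs_pos.2 hu)]

/-- The half derivative quotient of the normalized profile. -/
def GQ (n : ℕ) (t s : ℝ) : ℝ := (FF n s - FF n t) / |s - t| ^ (3 / 2 : ℝ)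

lemma GQ_self (n : ℕ) (t : ℝ) : GQ n t t = 0 := by simp [GQ]

lemma GQ_abs (n : ℕ) (t s : ℝ) : |GQ n t s| = |FF n s - FF n t| / (|s - t| * √|s - t|) := by
  rw [GQ, rpow_three_half (abs_nonneg _), abs_div, abs_of_nonneg (a := |s - t| * √|s - t|)
    (by positivity)]

lemma GQ_near (n : ℕ) (t s a A : ℝ) (hA : 0 ≤ A) (h : |s - t| ≤ a)
    (hF : |FF n s - FF n t| ≤ A * |s - t|) : |GQ n t s| ≤ A * nearK a (s - t) := by
  rcases eq_or_ne s t with rfl | hst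
  · rw [GQ_self, abs_zero]; exact mul_nonneg hA (nearK_nonneg _ _)
  · have h0 : s - t ≠ 0 := sub_ne_zero.2 hst
    have h1 : 0 < |s - t| := abs_pos.2 h0
    rw [nearK_of h0 h, GQ_abs, div_le_iff₀ (by positivity)]
    refine hF.trans_eq ?_
    field_simp

lemma GQ_bound (n : ℕ) (hn : 1 ≤ n) : ∃ C : ℝ, 0 < C ∧ ∀ t : ℝ,
    |∫ s, GQ n t s| ≤ C ∧ |t| * |∫ s, GQ n t s| ≤ C := by
  obtain ⟨K, hK, f1, f2, f3, f4⟩ := FF_props n hn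
  have first : ∀ t, |∫ s, GQ n t s| ≤ 12 * K := by
    intro t
    refine (core (GQ n t) t 1 1 K (2 * K) 0 one_pos one_pos ?_).trans (by norm_num; linarith)
    intro s
    have z1 := mul_nonneg hK.le (nearK_nonneg 1 (s - t))
    have z2 := mul_nonneg hK.le (farK_nonneg 1 (s - t))
    rcases le_or_gt |s - t| 1 with h | h
    · have := GQ_near n t s 1 K hK.le h (f2 s t)
      linarith
    · have : |GQ n t s| ≤ 2 * K * farK 1 (s - t) := by
        have h1 : 0 < |s - t| := by linarith
        rw [farK_of one_pos h, GQ_abs, div_eq_mul_one_div]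
        gcongr
        have := abs_sub (FF n s) (FF n t)
        linarith [f1 s, f1 t]
      linarith
  have second : ∀ t, t ≠ 0 → |t| * |∫ s, GQ n t s| ≤ 100 * K := by
    intro t ht
    have hT : 0 < |t| := abs_pos.2 ht
    obtain ⟨q, hq⟩ : ∃ q, q = √|t| := ⟨_, rfl⟩
    have hq0 : 0 < q := by rw [hq]; positivity
    have hqq : |t| = q ^ 2 := by rw [hq, sq_sqrt hT.le]
    have hA : 0 ≤ 4 * K / (|t| * √|t|) := by positivity
    have hB : 0 ≤ 2 * K / q := by positivity
    have hD : 0 ≤ 4 * K / (|t| * √|t|) := by positivity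
    have := core (GQ n t) t (|t|/2) (2*|t|) (4 * K / (|t| * √|t|)) (2 * K / q)
      (4 * K / (|t| * √|t|)) (by positivity) (by positivity) ?_
    · have s1 : √(|t|/2) ≤ q := by rw [hq]; apply Real.sqrt_le_sqrt; linarith
      have s2 : q / 2 ≤ √(|t|/2) := by
        apply Real.le_sqrt_of_sq_le; rw [hqq]; nlinarith [sq_nonneg q]
      have s3 : √(2*|t|) ≤ 2 * q := by
        rw [Real.sqrt_le_left (by positivity), hqq]; nlinarith [sq_nonneg q]
      have s4 : 4 / √(|t|/2) ≤ 4 / (q / 2) := by gcongr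
      calc |t| * |∫ s, GQ n t s| ≤ |t| * (4 * K / (|t| * √|t|) * (4 * q) + 2 * K / q * (4 / (q/2)) +
            4 * K / (|t| * √|t|) * (4 * (2 * q))) := by
            refine mul_le_mul_of_nonneg_left (this.trans ?_) hT.le
            gcongr
        _ = 64 * K := by rw [← hq, hqq]; field_simp; ring
        _ ≤ 100 * K := by linarith
    intro s
    have z1 := mul_nonneg hA (nearK_nonneg (|t|/2) (s - t))
    have z2 := mul_nonneg hB (farK_nonneg (|t|/2) (s - t))
    have z3 := mul_nonneg hD (nearK_nonneg (2*|t|) s)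
    rcases le_or_gt |s - t| (|t|/2) with h | h
    · have := GQ_near n t s _ _ hA h (f4 t s ht h)
      linarith
    · have h1 : 0 < |s - t| := by linarith
      have ft : |FF n t| ≤ K / q := by
        have := f3 t
        rwa [← hq, mul_one_div] at this
      have fs := f3 s
      have ftri := abs_sub (FF n s) (FF n t)
      have hsq : q ≤ 2 * √|s - t| := by
        rw [hq, Real.sqrt_le_left (by positivity), mul_pow, Real.sq_sqrt h1.le]; linarith
      have hden : |t| * √|t| ≤ 4 * (|s - t| * √|s - t|) := by
        calc |t| * √|t| ≤ (2 * |s - t|) * (2 * √|s - t|) := by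
              rw [← hq]; gcongr; linarith
          _ = _ := by ring
      have hfar := farK_of (a := |t|/2) (by positivity) h
      set Z := |s - t| * √|s - t| with hZ
      have hZ0 : 0 < Z := by positivity
      have step : |GQ n t s| ≤ |FF n s| / Z + K / q / Z := by
        rw [GQ_abs, ← add_div]
        gcongr
        linarith
      have e1 : 2 * K / q * farK (|t|/2) (s - t) = 2 * (K / q / Z) := by
        rw [hfar]; ring
      rw [e1]
      have zz : 0 ≤ K / q / Z := by positivity
      rcases le_or_gt |s| (2 * |t|) with hs | hs
      · have : |FF n s| / Z ≤ 4 * K / (|t| * √|t|) * nearK (2*|t|) s := by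
          rcases eq_or_ne s 0 with rfl | hs0
          · rw [FF_np n le_rfl]; simpa using z3
          · rw [nearK_of hs0 hs]
            have : 1 / Z ≤ 4 / (|t| * √|t|) := by
              rw [div_le_div_iff₀ hZ0 (by positivity)]; linarith
            calc |FF n s| / Z = |FF n s| * (1 / Z) := by ring
              _ ≤ K * (1 / √|s|) * (4 / (|t| * √|t|)) := by gcongr
              _ = _ := by ring
        linarith
      · have : |FF n s| ≤ K / q := by
          refine fs.trans ?_
          rw [mul_one_div, hq]
          have hsq2 : √|t| ≤ √|s| := Real.sqrt_le_sqrt (by linarith)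
          exact div_le_div_of_nonneg_left hK.le (by positivity) hsq2
        have : |FF n s| / Z ≤ K / q / Z := by gcongr
        linarith
  refine ⟨100 * K, by positivity, fun t => ⟨(first t).trans (by linarith), ?_⟩⟩
  rcases eq_or_ne t 0 with rfl | ht
  · simp; positivity
  · exact second t ht

lemma heatW_scale {n : ℕ} (x : Spc n) (hx : x ≠ 0) (s : ℝ) :
    heatW (x, s) = (‖x‖ ^ n)⁻¹ * FF n (s / ‖x‖ ^ 2) := by
  have hr : 0 < ‖x‖ := norm_pos_iff.2 hx
  unfold heatW FF
  have hiff : 0 < s / ‖x‖ ^ 2 ↔ 0 < s := div_pos_iff_of_pos_right (by positivity)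
  simp only [hiff]
  split_ifs with hs
  · have e1 : (4 * π * s) = (4 * π * (s / ‖x‖ ^ 2)) * ‖x‖ ^ 2 := by field_simp
    have e2 : -‖x‖ ^ 2 / (4 * s) = -1 / (4 * (s / ‖x‖ ^ 2)) := by field_simp
    have e3 : (‖x‖ ^ 2) ^ (-(n:ℝ) / 2) = (‖x‖ ^ n)⁻¹ := by
      rw [← rpow_natCast, ← rpow_mul hr.le, ← rpow_natCast, ← rpow_neg hr.le]
      congr 1; push_cast; ring
    rw [e2]
    conv_lhs => rw [e1]
    rw [mul_rpow (by positivity) (by positivity), e3]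
    ring
  · simp

lemma halfT_scale {n : ℕ} (p : Pt n) (hx : p.1 ≠ 0) :
    halfT heatW p = (‖p.1‖ ^ (n + 1))⁻¹ * ∫ s, GQ n (p.2 / ‖p.1‖ ^ 2) s := by
  obtain ⟨x, t⟩ := p
  simp only at hx ⊢
  have hr : 0 < ‖x‖ := norm_pos_iff.2 hx
  have key : ∀ s : ℝ, (heatW (x, s) - heatW (x, t)) / |s - t| ^ (3 / 2 : ℝ)
      = (‖x‖ ^ (n + 3))⁻¹ * GQ n (t / ‖x‖ ^ 2) (s / ‖x‖ ^ 2) := by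
    intro s
    rw [heatW_scale x hx, heatW_scale x hx, GQ, ← sub_div, abs_div,
      abs_of_pos (a := ‖x‖ ^ 2) (by positivity), div_rpow (abs_nonneg _) (by positivity),
      rpow_three_half (s := ‖x‖ ^ 2) (by positivity), Real.sqrt_sq hr.le, pow_add]
    field_simp
  unfold halfT
  simp only [key]
  rw [integral_const_mul, Measure.integral_comp_div (GQ n (t / ‖x‖ ^ 2)),
    abs_of_pos (by positivity), smul_eq_mul, pow_add, pow_add]
  field_simp

/-- `|∂_t^{1/2} W(x̄)| ≤ C / (|x|^{n-1} |x̄|_p²)` for `x ≠ 0`. -/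
theorem halfT_heatW_le (n : ℕ) (hn : 1 ≤ n) :
    ∃ C : ℝ, 0 < C ∧ ∀ p : Pt n, p.1 ≠ 0 →
      |halfT heatW p| ≤ C / (‖p.1‖ ^ (n - 1) * pnorm p ^ 2) := by
  obtain ⟨C, hC, hb⟩ := GQ_bound n hn
  refine ⟨C, hC, fun p hx => ?_⟩
  have hr : 0 < ‖p.1‖ := norm_pos_iff.2 hx
  obtain ⟨b1, b2⟩ := hb (p.2 / ‖p.1‖ ^ 2)
  rw [halfT_scale p hx, abs_mul, abs_of_pos (by positivity)]
  set J := |∫ s, GQ n (p.2 / ‖p.1‖ ^ 2) s| with hJ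
  rw [abs_div, abs_of_pos (a := ‖p.1‖ ^ 2) (by positivity), div_mul_eq_mul_div,
    div_le_iff₀ (by positivity)] at b2
  have hp : 0 < pnorm p := lt_of_lt_of_le hr (le_max_left _ _)
  have hm : pnorm p ^ 2 * J ≤ C * ‖p.1‖ ^ 2 := by
    unfold pnorm
    rcases max_choice ‖p.1‖ (√|p.2|) with h | h
    · rw [h, mul_comm]; gcongr
    · rw [h, Real.sq_sqrt (abs_nonneg _)]; exact b2
  obtain ⟨m, rfl⟩ : ∃ m, n = m + 1 := ⟨n - 1, by omega⟩
  rw [Nat.add_sub_cancel, le_div_iff₀ (by positivity)]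
  calc (‖p.1‖ ^ (m + 1 + 1))⁻¹ * J * (‖p.1‖ ^ m * pnorm p ^ 2)
      = (‖p.1‖ ^ 2)⁻¹ * (pnorm p ^ 2 * J) := by
        rw [show m + 1 + 1 = m + 2 from rfl, pow_add]; field_simp
    _ ≤ (‖p.1‖ ^ 2)⁻¹ * (C * ‖p.1‖ ^ 2) := by gcongr
    _ = C := by field_simp
end
end

section
/- Let n ≥ 1 and define f : ℝ → ℝ by f(s) = s^{-n/2} e^{-1/s} for s > 0 and f(s) = 0 for s ≤ 0. Then there is a constant C depending only on n such that for every t ∈ ℝ, the half derivative ∂_t^{1/2} f(t) = ∫_ℝ (f(s) − f(t))/|s−t|^{3/2} ds satisfies |∂_t^{1/2} f(t)| ≤ C min(1, |t|^{-1}). -/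
open MeasureTheory Real Set

noncomputable section

/-- The profile function `f(s) = s^{-n/2} e^{-1/s}` for `s > 0`, `0` otherwise. -/
def profileF (n : ℕ) (s : ℝ) : ℝ :=
  if 0 < s then s ^ (-(n : ℝ) / 2) * Real.exp (-1 / s) else 0

def gker (r : ℝ) : ℝ := if r ≤ 1 then r ^ (-(1/2) : ℝ) else r ^ (-(3/2) : ℝ)

lemma gker_integrable : Integrable (fun x : ℝ => gker |x|) := by
  have h : IntegrableOn gker (Ioi 0) := by
    rw [← Ioc_union_Ioi_eq_Ioi (zero_le_one : (0:ℝ) ≤ 1)]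
    apply IntegrableOn.union
    · have h1 : IntegrableOn (fun x : ℝ => x ^ (-(1/2) : ℝ)) (Ioc 0 1) := by
        rw [← intervalIntegrable_iff_integrableOn_Ioc_of_le zero_le_one]
        exact intervalIntegral.intervalIntegrable_rpow' (by norm_num)
      refine h1.congr_fun ?_ measurableSet_Ioc
      intro x hx
      simp [gker, hx.2]
    · have h1 : IntegrableOn (fun x : ℝ => x ^ (-(3/2) : ℝ)) (Ioi 1) :=
        integrableOn_Ioi_rpow_of_lt (by norm_num) one_pos
      refine h1.congr_fun ?_ measurableSet_Ioi
      intro x hx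
      simp only [gker, if_neg (not_le.2 (mem_Ioi.1 hx))]
  have hp : IntegrableOn (fun x : ℝ => gker |x|) (Ioi 0) := by
    refine h.congr_fun ?_ measurableSet_Ioi
    intro x hx
    simp only [abs_of_pos (mem_Ioi.1 hx)]
  have hq : IntegrableOn (fun x : ℝ => gker |x|) (Iic 0) := by
    rw [integrableOn_Iic_iff_integrableOn_Iio]
    have h5 := IntegrableOn.comp_neg (s := Ioi (0:ℝ)) hp
    simpa using h5
  have := hq.union hp
  rwa [Iic_union_Ioi, integrableOn_univ] at this

lemma gker_nonneg (r : ℝ) (hr : 0 ≤ r) : 0 ≤ gker r := by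
  unfold gker; split_ifs <;> positivity

lemma int_gker_nonneg : 0 ≤ ∫ x : ℝ, gker |x| :=
  integral_nonneg fun x => gker_nonneg _ (abs_nonneg x)

/-- elementary exponential bound -/
lemma pexp_bound (k : ℕ) (s : ℝ) (hs : 0 < s) :
    s ^ (-(k : ℝ) / 2) * Real.exp (-1 / s) ≤ 1 + (k.factorial : ℝ) := by
  have hx : 0 < s⁻¹ := inv_pos.2 hs
  have e1 : s ^ (-(k : ℝ) / 2) = (s⁻¹) ^ ((k : ℝ) / 2) := by
    rw [Real.inv_rpow hs.le, ← Real.rpow_neg hs.le]; congr 1; ring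
  have e2 : Real.exp (-1 / s) = (Real.exp s⁻¹)⁻¹ := by
    rw [← Real.exp_neg]; congr 1; field_simp
  rw [e1, e2, ← div_eq_mul_inv, div_le_iff₀ (Real.exp_pos _)]
  have h1 : (s⁻¹) ^ ((k : ℝ) / 2) ≤ 1 + (s⁻¹) ^ k := by
    rcases le_total s⁻¹ 1 with h | h
    · have : (s⁻¹) ^ ((k : ℝ) / 2) ≤ 1 := Real.rpow_le_one hx.le h (by positivity)
      have : 0 ≤ (s⁻¹) ^ k := by positivity
      linarith
    · have : (s⁻¹) ^ ((k : ℝ) / 2) ≤ (s⁻¹) ^ (k : ℝ) :=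
        Real.rpow_le_rpow_of_exponent_le h (by have : (0:ℝ) ≤ k := by positivity
                                               linarith)
      rw [Real.rpow_natCast] at this
      linarith
  have h2 := Real.pow_div_factorial_le_exp s⁻¹ hx.le k
  rw [div_le_iff₀ (by positivity)] at h2
  have h3 : 1 ≤ Real.exp s⁻¹ := Real.one_le_exp hx.le
  linarith

def pder (n : ℕ) (s : ℝ) : ℝ :=
  (-(n : ℝ) / 2) * s ^ (-(n : ℝ) / 2 - 1) * Real.exp (-1 / s) +
    s ^ (-(n : ℝ) / 2) * (Real.exp (-1 / s) * (s ^ 2)⁻¹)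

lemma profileF_pos (n : ℕ) {s : ℝ} (hs : 0 < s) :
    profileF n s = s ^ (-(n : ℝ) / 2) * Real.exp (-1 / s) := if_pos hs

lemma profileF_nonpos (n : ℕ) {s : ℝ} (hs : s ≤ 0) : profileF n s = 0 := if_neg (not_lt.2 hs)

lemma profileF_nonneg (n : ℕ) (s : ℝ) : 0 ≤ profileF n s := by
  unfold profileF; split_ifs <;> positivity

lemma profileF_hasDeriv (n : ℕ) {s : ℝ} (hs : 0 < s) :
    HasDerivAt (profileF n) (pder n s) s := by
  have h1 : HasDerivAt (fun x : ℝ => x ^ (-(n : ℝ) / 2))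
      ((-(n : ℝ) / 2) * s ^ (-(n : ℝ) / 2 - 1)) s := Real.hasDerivAt_rpow_const (Or.inl hs.ne')
  have h2 : HasDerivAt (fun x : ℝ => -1 / x) ((s ^ 2)⁻¹) s := by
    have := (hasDerivAt_inv hs.ne').neg
    have e : (fun x : ℝ => -1 / x) = -fun y : ℝ => y⁻¹ := by
      funext x; simp [div_eq_mul_inv]
    rw [e]
    simpa using this
  have h3 := h1.mul h2.exp
  refine h3.congr_of_eventuallyEq ?_
  filter_upwards [lt_mem_nhds hs] with x hx
  simp [profileF_pos n hx]

lemma pder_bound (n : ℕ) (s : ℝ) (hs : 0 < s) (hn : 1 ≤ n) :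
    |pder n s| ≤ n * (1 + (n + 2).factorial) + (1 + (n + 4).factorial) ∧
    |pder n s| ≤ (n * (1 + (n - 1).factorial) + (1 + (n + 1).factorial)) * s ^ (-(3/2) : ℝ) := by
  have key : |pder n s| ≤ n * (s ^ (-(n : ℝ) / 2 - 1) * Real.exp (-1 / s)) +
      s ^ (-(n : ℝ) / 2 - 2) * Real.exp (-1 / s) := by
    unfold pder
    have e : s ^ (-(n : ℝ) / 2) * (Real.exp (-1 / s) * (s ^ 2)⁻¹) =
        s ^ (-(n : ℝ) / 2 - 2) * Real.exp (-1 / s) := by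
      rw [Real.rpow_sub hs]
      norm_num
      field_simp
    rw [e]
    have p1 : 0 ≤ s ^ (-(n : ℝ) / 2 - 1) * Real.exp (-1 / s) := by positivity
    have p2 : 0 ≤ s ^ (-(n : ℝ) / 2 - 2) * Real.exp (-1 / s) := by positivity
    have p3 : (0:ℝ) ≤ n := by positivity
    have p4 := mul_nonneg p3 p1
    rw [abs_le]
    constructor <;> nlinarith
  have a1 := pexp_bound (n+2) s hs
  have a2 := pexp_bound (n+4) s hs
  have a3 := pexp_bound (n-1) s hs
  have a4 := pexp_bound (n+1) s hs
  have p3 : (0:ℝ) ≤ n := by positivity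
  constructor
  · have e1 : -((n + 2 : ℕ) : ℝ) / 2 = -(n : ℝ) / 2 - 1 := by push_cast; ring
    have e2 : -((n + 4 : ℕ) : ℝ) / 2 = -(n : ℝ) / 2 - 2 := by push_cast; ring
    rw [e1] at a1
    rw [e2] at a2
    have := mul_le_mul_of_nonneg_left a1 p3
    linarith
  · have e1 : s ^ (-(n : ℝ) / 2 - 1) = s ^ (-((n - 1 : ℕ) : ℝ) / 2) * s ^ (-(3/2) : ℝ) := by
      rw [← Real.rpow_add hs]; congr 1; push_cast [Nat.cast_sub hn]; ring
    have e2 : s ^ (-(n : ℝ) / 2 - 2) = s ^ (-((n + 1 : ℕ) : ℝ) / 2) * s ^ (-(3/2) : ℝ) := by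
      rw [← Real.rpow_add hs]; congr 1; push_cast; ring
    have q : 0 ≤ s ^ (-(3/2) : ℝ) := by positivity
    have := mul_le_mul_of_nonneg_right (add_le_add (mul_le_mul_of_nonneg_left a3 p3) a4) q
    refine key.trans (le_trans (le_of_eq ?_) this)
    rw [e1, e2]; ring

lemma profile_facts (n : ℕ) (hn : 1 ≤ n) : ∃ M : ℝ, 0 < M ∧ (∀ s, profileF n s ≤ M) ∧
    (∀ s, 0 < s → profileF n s ≤ M * s ^ (-(1/2) : ℝ)) ∧
    (∀ s t, |profileF n s - profileF n t| ≤ M * |s - t|) ∧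
    (∀ s t, 0 < t → |s - t| ≤ t / 2 →
      |profileF n s - profileF n t| ≤ M * t ^ (-(3/2) : ℝ) * |s - t|) := by
  set A : ℝ := n * (1 + (n + 2).factorial) + (1 + (n + 4).factorial) with hA
  set B : ℝ := n * (1 + (n - 1).factorial) + (1 + (n + 1).factorial) with hB
  have hApos : 0 < A := by positivity
  have hBpos : 0 < B := by positivity
  have f1 : ∀ s, profileF n s ≤ 1 + n.factorial := by
    intro s
    rcases lt_or_ge 0 s with h | h
    · rw [profileF_pos n h]; exact pexp_bound n s h
    · rw [profileF_nonpos n h]; positivity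
  have f2 : ∀ s, 0 < s → profileF n s ≤ (1 + (n-1).factorial) * s ^ (-(1/2) : ℝ) := by
    intro s h
    rw [profileF_pos n h]
    have e1 : s ^ (-(n : ℝ) / 2) = s ^ (-((n - 1 : ℕ) : ℝ) / 2) * s ^ (-(1/2) : ℝ) := by
      rw [← Real.rpow_add h]; congr 1; push_cast [Nat.cast_sub hn]; ring
    have q : 0 ≤ s ^ (-(1/2) : ℝ) := by positivity
    have := mul_le_mul_of_nonneg_right (pexp_bound (n-1) s h) q
    refine le_trans (le_of_eq ?_) this
    rw [e1]; ring
  have f2' : ∀ s, 0 < s → profileF n s ≤ (1 + (n+2).factorial) * s := by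
    intro s h
    rw [profileF_pos n h]
    have e1 : s ^ (-(n : ℝ) / 2) = s ^ (-((n + 2 : ℕ) : ℝ) / 2) * s := by
      nth_rw 3 [← Real.rpow_one s]
      rw [← Real.rpow_add h]; congr 1; push_cast; ring
    have := mul_le_mul_of_nonneg_right (pexp_bound (n+2) s h) h.le
    refine le_trans (le_of_eq ?_) this
    rw [e1]; ring
  have f3 : ∀ s t, 0 < s → 0 < t → |profileF n s - profileF n t| ≤ A * |s - t| := by
    intro s t hs ht
    exact (convex_Ioi (0:ℝ)).norm_image_sub_le_of_norm_hasDerivWithin_le (f := profileF n)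
      (f' := pder n) (fun x hx => (profileF_hasDeriv n hx).hasDerivWithinAt)
      (fun x hx => (pder_bound n x hx hn).1) ht hs
  have f3' : ∀ s t, s ≤ 0 → 0 < t →
      |profileF n s - profileF n t| ≤ (1 + (n+2).factorial) * |s - t| := by
    intro s t hs ht
    rw [profileF_nonpos n hs, zero_sub, abs_neg, abs_of_nonneg (profileF_nonneg n t)]
    refine (f2' t ht).trans ?_
    gcongr
    rw [abs_sub_comm]
    exact le_trans (by linarith) (le_abs_self _)
  have f4 : ∀ s t, 0 < t → |s - t| ≤ t / 2 →
      |profileF n s - profileF n t| ≤ B * (t/2) ^ (-(3/2) : ℝ) * |s - t| := by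
    intro s t ht hst
    have hs : t / 2 ≤ s := by have := (abs_le.1 hst).1; linarith
    refine (convex_Ici (t/2)).norm_image_sub_le_of_norm_hasDerivWithin_le (f := profileF n)
      (f' := pder n) (fun x hx => (profileF_hasDeriv n ?_).hasDerivWithinAt)
      (fun x hx => ?_) (by simp; linarith) hs
    · exact lt_of_lt_of_le (by linarith) (mem_Ici.1 hx)
    · have hx' : 0 < x := lt_of_lt_of_le (by linarith) (mem_Ici.1 hx)
      refine (pder_bound n x hx' hn).2.trans ?_
      exact mul_le_mul_of_nonneg_left (Real.rpow_le_rpow_of_nonpos (z := -(3/2))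
        (by linarith) hx (by norm_num)) hBpos.le
  have c2 : (0:ℝ) < (1/2 : ℝ) ^ (-(3/2) : ℝ) := by positivity
  set c : ℝ := (1/2 : ℝ) ^ (-(3/2) : ℝ) with hc
  have n0 : (0:ℝ) < n.factorial := by positivity
  have n1 : (0:ℝ) < (n-1).factorial := by positivity
  have n2 : (0:ℝ) < (n+2).factorial := by positivity
  have n3 : 0 < B * c := by positivity
  refine ⟨(1 + n.factorial) + (1 + (n-1).factorial) + (1 + (n+2).factorial) + A + B * c,
    by positivity, fun s => (f1 s).trans (by linarith), fun s hs => (f2 s hs).trans ?_, ?_, ?_⟩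
  · exact mul_le_mul_of_nonneg_right (by linarith) (by positivity)
  · intro s t
    rcases lt_or_ge 0 s with h | h <;> rcases lt_or_ge 0 t with h' | h'
    · exact (f3 s t h h').trans (mul_le_mul_of_nonneg_right (by linarith) (abs_nonneg _))
    · rw [abs_sub_comm, abs_sub_comm s]
      exact (f3' t s h' h).trans (mul_le_mul_of_nonneg_right (by linarith) (abs_nonneg _))
    · exact (f3' s t h h').trans (mul_le_mul_of_nonneg_right (by linarith) (abs_nonneg _))
    · rw [profileF_nonpos n h, profileF_nonpos n h']
      simp; positivity
  · intro s t ht hst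
    refine (f4 s t ht hst).trans ?_
    have : (t/2) ^ (-(3/2) : ℝ) = c * t ^ (-(3/2) : ℝ) := by
      rw [hc, ← Real.mul_rpow (by norm_num) ht.le]; congr 1; ring
    rw [this, ← mul_assoc]
    gcongr
    linarith

lemma div_le_half {d M r : ℝ} (hr : 0 ≤ r) (hM : 0 ≤ M) (h : d ≤ M * r) :
    d / r ^ (3 / 2 : ℝ) ≤ M * r ^ (-(1/2) : ℝ) := by
  rcases hr.eq_or_lt with rfl | hr
  · rw [Real.zero_rpow (by norm_num), div_zero]
    positivity
  · rw [div_le_iff₀ (by positivity), mul_assoc, ← Real.rpow_add hr]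
    norm_num; exact h

lemma div_eq_three {d r : ℝ} (hr : 0 ≤ r) : d / r ^ (3 / 2 : ℝ) = d * r ^ (-(3/2) : ℝ) := by
  rw [Real.rpow_neg hr, div_eq_mul_inv]

lemma three_le (r : ℝ) (hr : 1/2 ≤ r) : r ^ (-(3/2) : ℝ) ≤ 2 * gker r := by
  have h0 : 0 < r := by linarith
  unfold gker
  split_ifs with h
  · have : r ^ (-(3/2) : ℝ) = r⁻¹ * r ^ (-(1/2) : ℝ) := by
      rw [← Real.rpow_neg_one, ← Real.rpow_add h0]; norm_num
    rw [this]
    gcongr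
    rw [inv_le_comm₀ h0 two_pos]; linarith
  · have : 0 ≤ r ^ (-(3/2) : ℝ) := by positivity
    linarith

lemma main_ptw {h : ℝ → ℝ} {M : ℝ} (hM : 0 < M) (h0 : ∀ u, 0 ≤ h u)
    (hneg : ∀ u, u ≤ 0 → h u = 0) (h1 : ∀ u, 0 < u → h u ≤ M * u ^ (-(1/2) : ℝ))
    (h2 : ∀ u, |u - 1| ≤ 1/2 → |h u - h 1| ≤ M * |u - 1|) (τ : ℝ) (hτ : τ = 1 ∨ τ = -1) (u : ℝ) :
    |(h u - h τ) / |u - τ| ^ (3 / 2 : ℝ)| ≤ 10 * M * (gker |u - τ| + gker |u|) := by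
  have g1 := gker_nonneg _ (abs_nonneg (u - τ))
  have g2 := gker_nonneg _ (abs_nonneg u)
  rw [abs_div, abs_of_nonneg (by positivity : 0 ≤ |u - τ| ^ (3 / 2 : ℝ))]
  by_cases hc : τ = 1 ∧ |u - 1| ≤ 1/2
  · obtain ⟨rfl, hc⟩ := hc
    refine (div_le_half (abs_nonneg _) hM.le (h2 u hc)).trans ?_
    have : |u - 1| ^ (-(1/2) : ℝ) = gker |u - 1| := by
      unfold gker; rw [if_pos (by linarith)]
    rw [this]
    nlinarith
  · -- separate terms
    have hsep : |h u - h τ| ≤ h u + h τ := by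
      rw [abs_le]; constructor <;> linarith [h0 u, h0 τ]
    have hA : h τ / |u - τ| ^ (3 / 2 : ℝ) ≤ 2 * M * gker |u - τ| := by
      rcases hτ with rfl | rfl
      · have hc' : 1/2 ≤ |u - 1| := by
          by_contra hcc; exact hc ⟨rfl, by linarith⟩
        have := h1 1 one_pos
        rw [Real.one_rpow] at this
        rw [div_eq_three (abs_nonneg _)]
        have t := three_le _ hc'
        calc h 1 * |u - 1| ^ (-(3/2) : ℝ) ≤ (M * 1) * (2 * gker |u - 1|) := by
              gcongr
          _ = _ := by ring
      · rw [hneg (-1) (by norm_num), zero_div]; positivity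
    have hB : h u / |u - τ| ^ (3 / 2 : ℝ) ≤ 8 * M * gker |u| := by
      rcases le_or_gt u 0 with hu | hu
      · rw [hneg u hu, zero_div]; positivity
      · have hd : 1/2 ≤ |u - τ| ∧ u / 3 ≤ |u - τ| := by
          rcases hτ with rfl | rfl
          · have hc' : 1/2 < |u - 1| := by
              by_contra hcc; exact hc ⟨rfl, by linarith⟩
            refine ⟨hc'.le, ?_⟩
            rcases lt_abs.1 hc' with h | h
            · exact le_trans (by linarith) (le_abs_self _)
            · exact le_trans (by linarith) (neg_le_abs _)
          · exact ⟨le_trans (by linarith) (le_abs_self _), le_trans (by linarith) (le_abs_self _)⟩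
        rw [div_eq_three (abs_nonneg _), abs_of_pos hu]
        have k3 : (1/3 : ℝ) ^ (-(3/2) : ℝ) ≤ 8 := by
          rw [one_div, Real.inv_rpow (by norm_num), ← Real.rpow_neg (by norm_num)]
          calc (3:ℝ) ^ (- -(3/2) : ℝ) ≤ (4:ℝ) ^ (- -(3/2) : ℝ) := by
                gcongr <;> norm_num
            _ = 8 := by
                rw [show (4:ℝ) = 2 ^ (2:ℝ) by norm_num, ← Real.rpow_mul (by norm_num)]
                norm_num
        have k2 : (1/2 : ℝ) ^ (-(3/2) : ℝ) ≤ 8 :=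
          (Real.rpow_le_rpow_of_nonpos (by norm_num) (by norm_num) (by norm_num)).trans k3
        unfold gker
        split_ifs with hu1
        · have : |u - τ| ^ (-(3/2) : ℝ) ≤ 8 :=
            (Real.rpow_le_rpow_of_nonpos (by norm_num) hd.1 (by norm_num)).trans k2
          calc h u * |u - τ| ^ (-(3/2) : ℝ) ≤ (M * u ^ (-(1/2) : ℝ)) * 8 := by
                gcongr
                exact h1 u hu
            _ = _ := by ring
        · have : |u - τ| ^ (-(3/2) : ℝ) ≤ 8 * u ^ (-(3/2) : ℝ) := by
            refine (Real.rpow_le_rpow_of_nonpos (by positivity) hd.2 (by norm_num)).trans ?_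
            rw [show u / 3 = (1/3) * u by ring, Real.mul_rpow (by norm_num) hu.le]
            gcongr
          have hu' : u ^ (-(1/2) : ℝ) ≤ 1 :=
            Real.rpow_le_one_of_one_le_of_nonpos (by linarith) (by norm_num)
          calc h u * |u - τ| ^ (-(3/2) : ℝ) ≤ (M * 1) * (8 * u ^ (-(3/2) : ℝ)) := by
                gcongr
                exact (h1 u hu).trans (by gcongr)
            _ = _ := by ring
    calc |h u - h τ| / |u - τ| ^ (3 / 2 : ℝ) ≤ (h u + h τ) / |u - τ| ^ (3 / 2 : ℝ) := by gcongr
      _ = h u / |u - τ| ^ (3 / 2 : ℝ) + h τ / |u - τ| ^ (3 / 2 : ℝ) := add_div _ _ _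
      _ ≤ _ := by nlinarith [mul_nonneg hM.le g1, mul_nonneg hM.le g2]

lemma bound_one {f : ℝ → ℝ} {M : ℝ} (hM : 0 < M) (h0 : ∀ u, 0 ≤ f u) (h1 : ∀ u, f u ≤ M)
    (h3 : ∀ s t, |f s - f t| ≤ M * |s - t|) (t : ℝ) :
    |∫ s : ℝ, (f s - f t) / |s - t| ^ (3 / 2 : ℝ)| ≤ M * ∫ x : ℝ, gker |x| := by
  rw [← Real.norm_eq_abs]
  have hi : Integrable (fun s : ℝ => M * gker |s - t|) :=
    (gker_integrable.comp_sub_right t).const_mul M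
  refine (norm_integral_le_of_norm_le hi (Filter.Eventually.of_forall fun s => ?_)).trans
    (le_of_eq ?_)
  · rw [Real.norm_eq_abs, abs_div, abs_of_nonneg (by positivity : 0 ≤ |s - t| ^ (3 / 2 : ℝ))]
    unfold gker
    split_ifs with h
    · exact div_le_half (abs_nonneg _) hM.le (h3 s t)
    · rw [div_eq_three (abs_nonneg _)]
      gcongr
      rw [abs_le]; constructor <;> linarith [h0 s, h0 t, h1 s, h1 t]
  · rw [integral_const_mul, integral_sub_right_eq_self (fun x : ℝ => gker |x|) t]

lemma bound_two {h : ℝ → ℝ} {M : ℝ} (hM : 0 < M) (h0 : ∀ u, 0 ≤ h u)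
    (hneg : ∀ u, u ≤ 0 → h u = 0) (h1 : ∀ u, 0 < u → h u ≤ M * u ^ (-(1/2) : ℝ))
    (h2 : ∀ u, |u - 1| ≤ 1/2 → |h u - h 1| ≤ M * |u - 1|) (τ : ℝ) (hτ : τ = 1 ∨ τ = -1) :
    |∫ u : ℝ, (h u - h τ) / |u - τ| ^ (3 / 2 : ℝ)| ≤ 20 * M * ∫ x : ℝ, gker |x| := by
  rw [← Real.norm_eq_abs]
  have hi0 : Integrable (fun s : ℝ => gker |s - τ|) := gker_integrable.comp_sub_right τ
  have hi : Integrable (fun s : ℝ => 10 * M * (gker |s - τ| + gker |s|)) :=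
    (hi0.add gker_integrable).const_mul _
  refine (norm_integral_le_of_norm_le hi (Filter.Eventually.of_forall fun s =>
    main_ptw hM h0 hneg h1 h2 τ hτ s)).trans (le_of_eq ?_)
  rw [integral_const_mul, integral_add hi0 gker_integrable,
    integral_sub_right_eq_self (fun x : ℝ => gker |x|) τ]
  ring

lemma scale (f : ℝ → ℝ) (a τ : ℝ) (ha : 0 < a) :
    ∫ s : ℝ, (f s - f (a * τ)) / |s - a * τ| ^ (3 / 2 : ℝ) =
    a⁻¹ * ∫ u : ℝ, (a ^ (1/2 : ℝ) * f (a * u) - a ^ (1/2 : ℝ) * f (a * τ)) /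
      |u - τ| ^ (3 / 2 : ℝ) := by
  have h := Measure.integral_comp_mul_left
    (fun s : ℝ => (f s - f (a * τ)) / |s - a * τ| ^ (3 / 2 : ℝ)) a
  rw [abs_of_pos (inv_pos.2 ha), smul_eq_mul] at h
  have h' : ∫ s : ℝ, (f s - f (a * τ)) / |s - a * τ| ^ (3 / 2 : ℝ) =
      a * ∫ u : ℝ, (f (a * u) - f (a * τ)) / |a * u - a * τ| ^ (3 / 2 : ℝ) := by
    rw [h]; field_simp
  rw [h', ← integral_const_mul, ← integral_const_mul]
  congr 1
  funext u
  rw [← mul_sub, ← mul_sub, abs_mul, abs_of_pos ha, Real.mul_rpow ha.le (abs_nonneg _)]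
  have e : a ^ (3/2 : ℝ) = a * a ^ (1/2 : ℝ) := by
    nth_rw 2 [← Real.rpow_one a]
    rw [← Real.rpow_add ha]; norm_num
  have e2 : a ^ (1/2 : ℝ) * a ^ (1/2 : ℝ) = a := by
    rw [← Real.rpow_add ha]; norm_num
  have p : 0 < a ^ (1/2 : ℝ) := by positivity
  rw [e]
  set b := a ^ (1/2 : ℝ)
  rw [← e2]
  by_cases hz : |u - τ| ^ (3 / 2 : ℝ) = 0
  · rw [hz]; simp
  · field_simp

/-- `|∂_t^{1/2} f(t)| ≤ C min(1, |t|⁻¹)`, stated as the conjunction of the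
two bounds `≤ C` (all `t`) and `≤ C |t|⁻¹` (for `t ≠ 0`). -/
theorem halfDeriv_profileF_le (n : ℕ) (hn : 1 ≤ n) :
    ∃ C : ℝ, 0 < C ∧ ∀ t : ℝ,
      (|∫ s : ℝ, (profileF n s - profileF n t) / |s - t| ^ (3 / 2 : ℝ)| ≤ C) ∧
      (t ≠ 0 →
        |∫ s : ℝ, (profileF n s - profileF n t) / |s - t| ^ (3 / 2 : ℝ)| ≤ C * |t|⁻¹) := by
  obtain ⟨M, hM, f1, f2, f3, f4⟩ := profile_facts n hn
  have hG := int_gker_nonneg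
  set G := ∫ x : ℝ, gker |x| with hGdef
  refine ⟨20 * M * G + 1, by positivity, fun t => ⟨?_, fun ht => ?_⟩⟩
  · have := bound_one hM (profileF_nonneg n) f1 f3 t
    nlinarith [mul_nonneg hM.le hG]
  · have ha : 0 < |t| := abs_pos.2 ht
    obtain ⟨τ, hτ, hτt⟩ : ∃ τ : ℝ, (τ = 1 ∨ τ = -1) ∧ |t| * τ = t := by
      rcases lt_or_gt_of_ne ht with h | h
      · exact ⟨-1, Or.inr rfl, by rw [abs_of_neg h]; ring⟩
      · exact ⟨1, Or.inl rfl, by rw [abs_of_pos h]; ring⟩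
    set a := |t| with hadef
    have hs := scale (profileF n) a τ ha
    rw [hτt] at hs
    have hb := bound_two (h := fun u => a ^ (1/2 : ℝ) * profileF n (a * u)) hM
      (fun u => mul_nonneg (by positivity) (profileF_nonneg n _))
      (fun u hu => by
        rw [profileF_nonpos n (mul_nonpos_of_nonneg_of_nonpos ha.le hu), mul_zero])
      (fun u hu => by
        have := f2 (a * u) (by positivity)
        calc a ^ (1/2 : ℝ) * profileF n (a * u)
            ≤ a ^ (1/2 : ℝ) * (M * (a * u) ^ (-(1/2) : ℝ)) := by gcongr
          _ = (a ^ (1/2 : ℝ) * a ^ (-(1/2) : ℝ)) * (M * u ^ (-(1/2) : ℝ)) := by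
              rw [Real.mul_rpow ha.le hu.le]; ring
          _ = _ := by rw [← Real.rpow_add ha]; norm_num)
      (fun u hu => by
        have e : |a * u - a| = a * |u - 1| := by
          rw [← mul_sub_one, abs_mul, abs_of_pos ha]
        have := f4 (a * u) a ha (by rw [e]; nlinarith)
        rw [← mul_sub, abs_mul, abs_of_pos (by positivity : 0 < a ^ (1/2 : ℝ)), mul_one]
        calc a ^ (1/2 : ℝ) * |profileF n (a * u) - profileF n a|
            ≤ a ^ (1/2 : ℝ) * (M * a ^ (-(3/2) : ℝ) * (a * |u - 1|)) := by
              rw [← e]; gcongr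
          _ = (a ^ (1/2 : ℝ) * a ^ (-(3/2) : ℝ) * a ^ (1 : ℝ)) * (M * |u - 1|) := by
              rw [Real.rpow_one]; ring
          _ = _ := by rw [← Real.rpow_add ha, ← Real.rpow_add ha]; norm_num) τ hτ
    simp only [hτt] at hb
    rw [hs, abs_mul, abs_of_pos (inv_pos.2 ha), mul_comm]
    gcongr
    linarith
end
end

section
/- Let n ≥ 1 and let W be the heat kernel on ℝ^{n+1}. There is a constant C depending only on n such that the following holds. Let Q ⊂ ℝ^{n+1} be a parabolic cube of side length ℓ(Q) and let g : ℝ^{n+1} → ℝ be a measurable function supported on Q with ‖g‖_∞ ≤ 1/ℓ(Q). Then for every x̄ ∈ ℝ^{n+1}, |∇_x W * g(x̄)| = |∫ ∇_x W(x̄ − ȳ) g(ȳ) dm(ȳ)| ≤ C, where m is Lebesgue measure on ℝ^{n+1}. -/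
open MeasureTheory Real Set

noncomputable section

lemma aux_measurable_gradW (n : ℕ) : Measurable (gradW : Pt n → Spc n) := by
  unfold gradW
  refine Measurable.ite (measurableSet_lt measurable_const measurable_snd) ?_ measurable_const
  have h : Measurable fun p : Pt n => (-(1 / (2 * p.2)) * (4 * π * p.2) ^ (-(n : ℝ) / 2) *
      Real.exp (-‖p.1‖ ^ 2 / (4 * p.2))) := by fun_prop
  exact h.smul measurable_fst

lemma aux_gradW_norm (n : ℕ) (x : Spc n) (t : ℝ) (ht : 0 < t) :
    ‖gradW ((x, t) : Pt n)‖ ≤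
      t ^ (-(1/2) : ℝ) * (4 * π * t) ^ (-(n : ℝ) / 2) * Real.exp (-(1 / (8 * t)) * ‖x‖ ^ 2) := by
  have hs : 0 < Real.sqrt t := Real.sqrt_pos.2 ht
  have hss : Real.sqrt t * Real.sqrt t = t := Real.mul_self_sqrt ht.le
  have hA : 0 < (4 * π * t) ^ (-(n : ℝ) / 2) := by positivity
  have e1 : t ^ (-(1/2) : ℝ) = 1 / Real.sqrt t := by
    rw [Real.rpow_neg ht.le, Real.sqrt_eq_rpow, one_div, one_div]
  have e2 : Real.exp (-‖x‖ ^ 2 / (4 * t)) =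
      Real.exp (-(1 / (8 * t)) * ‖x‖ ^ 2) * Real.exp (-(1 / (8 * t)) * ‖x‖ ^ 2) := by
    rw [← Real.exp_add]; congr 1; field_simp; ring
  set E := Real.exp (-(1 / (8 * t)) * ‖x‖ ^ 2) with hE
  have hE0 : 0 < E := Real.exp_pos _
  have key : 1 / (2 * t) * ‖x‖ * E ≤ 1 / Real.sqrt t := by
    have h1 : E = (Real.exp (‖x‖ ^ 2 / (8 * t)))⁻¹ := by
      rw [hE, ← Real.exp_neg]; congr 1; field_simp
    have h2 : ‖x‖ ^ 2 / (8 * t) + 1 ≤ Real.exp (‖x‖ ^ 2 / (8 * t)) := Real.add_one_le_exp _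
    have h3 : ‖x‖ / (2 * Real.sqrt t) ≤ ‖x‖ ^ 2 / (8 * t) + 1 := by
      have : ‖x‖ ^ 2 / (8 * t) = (‖x‖ / (2 * Real.sqrt t)) ^ 2 / 2 := by
        rw [div_pow, mul_pow, sq (Real.sqrt t), hss]; field_simp; norm_num
      rw [this]
      nlinarith [sq_nonneg (‖x‖ / (2 * Real.sqrt t) - 1)]
    have h4 := h3.trans h2
    have h5 : ‖x‖ / (2 * Real.sqrt t) * E ≤ 1 := by
      rw [h1, ← div_eq_mul_inv, div_le_one (Real.exp_pos _)]; exact h4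
    have h6 : 1 / (2 * t) * ‖x‖ * E = (1 / Real.sqrt t) * (‖x‖ / (2 * Real.sqrt t) * E) := by
      conv_lhs => rw [← hss]
      field_simp
    rw [h6]
    exact mul_le_of_le_one_right (by positivity) h5
  simp only [gradW, if_pos ht]
  rw [norm_smul, norm_mul, norm_mul, norm_neg, Real.norm_of_nonneg (by positivity : 0 ≤ 1 / (2*t)),
    Real.norm_of_nonneg hA.le, Real.norm_of_nonneg (Real.exp_pos _).le, e1, e2]
  calc _ = (1 / (2 * t) * ‖x‖ * E) * ((4 * π * t) ^ (-(n : ℝ) / 2) * E) := by ring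
    _ ≤ (1 / Real.sqrt t) * ((4 * π * t) ^ (-(n : ℝ) / 2) * E) := by gcongr
    _ = _ := by ring

lemma aux_inner (n : ℕ) (t : ℝ) (ht : 0 < t) :
    ∫⁻ x : Spc n, ‖gradW ((x, t) : Pt n)‖ₑ ≤
      ENNReal.ofReal ((2 : ℝ) ^ ((n : ℝ) / 2) * t ^ (-(1/2) : ℝ)) := by
  have hb : 0 < 1 / (8 * t) := by positivity
  have hI := GaussianFourier.integral_rexp_neg_mul_sq_norm (V := Spc n) hb
  have hint : Integrable (fun v : Spc n => Real.exp (-(1 / (8 * t)) * ‖v‖ ^ 2)) := by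
    by_contra h
    rw [integral_undef h] at hI
    have : 0 < (π / (1 / (8 * t))) ^ ((Module.finrank ℝ (Spc n) : ℝ) / 2) := by positivity
    exact absurd hI this.ne
  have hA : 0 ≤ t ^ (-(1/2) : ℝ) * (4 * π * t) ^ (-(n : ℝ) / 2) := by positivity
  calc _ ≤ ∫⁻ x : Spc n, ENNReal.ofReal (t ^ (-(1/2) : ℝ) * (4 * π * t) ^ (-(n : ℝ) / 2) *
        Real.exp (-(1 / (8 * t)) * ‖x‖ ^ 2)) := by
        refine lintegral_mono fun x => ?_
        rw [← ofReal_norm]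
        exact ENNReal.ofReal_le_ofReal (aux_gradW_norm n x t ht)
    _ = ENNReal.ofReal (∫ x : Spc n, t ^ (-(1/2) : ℝ) * (4 * π * t) ^ (-(n : ℝ) / 2) *
        Real.exp (-(1 / (8 * t)) * ‖x‖ ^ 2)) := by
        rw [ofReal_integral_eq_lintegral_ofReal (hint.const_mul _)]
        exact Filter.Eventually.of_forall fun x => by positivity
    _ = _ := by
        congr 1
        rw [integral_const_mul, hI, finrank_euclideanSpace, Fintype.card_fin]
        have e : π / (1 / (8 * t)) = 2 * (4 * π * t) := by field_simp; norm_num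
        have h4 : 0 < 4 * π * t := by positivity
        rw [e, Real.mul_rpow (by norm_num) h4.le, neg_div, Real.rpow_neg h4.le]
        have : (4 * π * t) ^ ((n : ℝ) / 2) ≠ 0 := by positivity
        field_simp

lemma aux_time (a l T : ℝ) (hl : 0 < l) :
    ∫⁻ s in Icc T (T + l ^ 2), (Ioi (0:ℝ)).indicator
      (fun u => ENNReal.ofReal (u ^ (-(1/2) : ℝ))) (a - s) ≤ ENNReal.ofReal (3 * l) := by
  have hl2 : 0 < l ^ 2 := by positivity
  have hle : (l ^ 2) ^ (-(1/2) : ℝ) = l⁻¹ := by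
    rw [Real.rpow_neg hl2.le, ← Real.sqrt_eq_rpow, Real.sqrt_sq hl.le]
  have h2 : ∫⁻ u in Ioc 0 (l ^ 2), ENNReal.ofReal (u ^ (-(1/2) : ℝ)) = ENNReal.ofReal (2 * l) := by
    have hii : IntervalIntegrable (fun u : ℝ => u ^ (-(1/2) : ℝ)) volume 0 (l ^ 2) :=
      intervalIntegral.intervalIntegrable_rpow' (by norm_num)
    rw [← ofReal_integral_eq_lintegral_ofReal, ← intervalIntegral.integral_of_le hl2.le,
      integral_rpow (Or.inl (by norm_num))]
    · congr 1
      rw [show (-(1/2) + 1 : ℝ) = 1/2 by norm_num, ← Real.sqrt_eq_rpow, Real.sqrt_sq hl.le,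
        Real.zero_rpow (by norm_num)]
      ring
    · exact (intervalIntegrable_iff_integrableOn_Ioc_of_le hl2.le).1 hii
    · filter_upwards [ae_restrict_mem measurableSet_Ioc] with u hu
      exact Real.rpow_nonneg hu.1.le _
  have hm : Measurable ((Ioc (0:ℝ) (l^2)).indicator
      (fun u => ENNReal.ofReal (u ^ (-(1/2) : ℝ)))) := by
    refine Measurable.indicator ?_ measurableSet_Ioc
    fun_prop
  calc _ ≤ ∫⁻ s in Icc T (T + l ^ 2), (ENNReal.ofReal l⁻¹ + (Ioc (0:ℝ) (l^2)).indicator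
        (fun u => ENNReal.ofReal (u ^ (-(1/2) : ℝ))) (a - s)) := by
        refine lintegral_mono fun s => ?_
        simp only [indicator_apply, mem_Ioi, mem_Ioc]
        by_cases h : 0 < a - s
        · by_cases h' : a - s ≤ l ^ 2
          · simp only [h, h', and_self, if_true]; exact le_add_self
          · simp only [h, h', if_true, and_false, if_false, add_zero]
            rw [← hle]
            exact ENNReal.ofReal_le_ofReal
              (Real.rpow_le_rpow_of_nonpos hl2 (not_le.1 h').le (by norm_num))
        · simp [h]
    _ = ENNReal.ofReal l⁻¹ * ENNReal.ofReal (l ^ 2) + ∫⁻ s in Icc T (T + l ^ 2),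
        (Ioc (0:ℝ) (l^2)).indicator (fun u => ENNReal.ofReal (u ^ (-(1/2) : ℝ))) (a - s) := by
        rw [lintegral_add_left measurable_const, setLIntegral_const, Real.volume_Icc]
        simp
    _ ≤ ENNReal.ofReal l + ∫⁻ s,
        (Ioc (0:ℝ) (l^2)).indicator (fun u => ENNReal.ofReal (u ^ (-(1/2) : ℝ))) (a - s) := by
        refine add_le_add ?_ (setLIntegral_le_lintegral _ _)
        rw [← ENNReal.ofReal_mul (by positivity)]
        refine le_of_eq ?_
        congr 1; field_simp
    _ = ENNReal.ofReal (3 * l) := by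
        rw [lintegral_sub_left_eq_self (μ := volume), lintegral_indicator measurableSet_Ioc, h2,
          ← ENNReal.ofReal_add (by positivity) (by positivity)]
        congr 1; ring

/-- if `g` is supported on a parabolic cube `Q` with `‖g‖_∞ ≤ 1/ℓ(Q)`,
then `‖∇ₓ W * g‖_∞ ≤ C`. -/
theorem gradW_conv_fun_le (n : ℕ) (hn : 1 ≤ n) :
    ∃ C : ℝ, 0 < C ∧ ∀ (Q : PCube n) (g : Pt n → ℝ), Measurable g →
      Function.support g ⊆ Q.toSet → (∀ y, |g y| ≤ 1 / Q.len) →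
      ∀ p : Pt n, ‖∫ y, g y • gradW (p - y)‖ ≤ C := by
  refine ⟨3 * (2 : ℝ) ^ ((n : ℝ) / 2), by positivity, ?_⟩
  intro Q g _ hsupp hg p
  have hl := Q.len_pos
  set I := Icc Q.time (Q.time + Q.len ^ 2) with hIdef
  have hC : (0:ℝ) ≤ (2 : ℝ) ^ ((n : ℝ) / 2) := by positivity
  have hmg : Measurable fun y : Pt n => ‖gradW (p - y)‖ₑ :=
    ((aux_measurable_gradW n).comp (measurable_const.sub measurable_id)).enorm
  have hmi : Measurable fun y : Pt n => I.indicator (fun _ => (1 : ENNReal)) y.2 :=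
    (measurable_const.indicator measurableSet_Icc).comp measurable_snd
  have hmt : Measurable fun s : ℝ => (Ioi (0:ℝ)).indicator
      (fun u => ENNReal.ofReal (u ^ (-(1/2) : ℝ))) (p.2 - s) := by
    refine (Measurable.indicator ?_ measurableSet_Ioi).comp (measurable_const.sub measurable_id)
    fun_prop
  have main : ‖∫ y, g y • gradW (p - y)‖ₑ ≤ ENNReal.ofReal (3 * (2 : ℝ) ^ ((n : ℝ) / 2)) := by
    calc _ ≤ ∫⁻ y, ‖g y • gradW (p - y)‖ₑ := enorm_integral_le_lintegral_enorm _
      _ ≤ ∫⁻ y : Pt n, ENNReal.ofReal (1 / Q.len) *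
          (I.indicator (fun _ => (1 : ENNReal)) y.2 * ‖gradW (p - y)‖ₑ) := by
          refine lintegral_mono fun y => ?_
          by_cases h : g y = 0
          · simp [h]
          · have hy : y.2 ∈ I := (hsupp h).2
            simp only [indicator_of_mem hy, one_mul, enorm_smul]
            gcongr
            rw [← ofReal_norm, Real.norm_eq_abs]
            exact ENNReal.ofReal_le_ofReal (hg y)
      _ = ENNReal.ofReal (1 / Q.len) * ∫⁻ s : ℝ, ∫⁻ x : Spc n,
          (I.indicator (fun _ => (1 : ENNReal)) s * ‖gradW (p - (x, s))‖ₑ) := by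
          have hm : Measurable fun y : Pt n =>
              I.indicator (fun _ => (1 : ENNReal)) y.2 * ‖gradW (p - y)‖ₑ := hmi.mul hmg
          rw [lintegral_const_mul _ hm, Measure.volume_eq_prod,
            lintegral_prod_symm _ hm.aemeasurable]
      _ ≤ ENNReal.ofReal (1 / Q.len) * ∫⁻ s : ℝ, I.indicator (fun s =>
          ENNReal.ofReal ((2 : ℝ) ^ ((n : ℝ) / 2)) * (Ioi (0:ℝ)).indicator
            (fun u => ENNReal.ofReal (u ^ (-(1/2) : ℝ))) (p.2 - s)) s := by
          gcongr with s
          by_cases hs : s ∈ I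
          · simp only [indicator_of_mem hs, one_mul]
            have e : ∫⁻ x : Spc n, ‖gradW (p - (x, s))‖ₑ =
                ∫⁻ x : Spc n, ‖gradW ((x, p.2 - s) : Pt n)‖ₑ :=
              lintegral_sub_left_eq_self (μ := volume)
                (fun x : Spc n => ‖gradW ((x, p.2 - s) : Pt n)‖ₑ) p.1
            rw [e]
            by_cases h : 0 < p.2 - s
            · rw [indicator_of_mem (show p.2 - s ∈ Ioi (0:ℝ) from h), ← ENNReal.ofReal_mul hC]
              exact aux_inner n _ h
            · simp [gradW, h]
          · simp [hs]
      _ ≤ ENNReal.ofReal (1 / Q.len) *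
          (ENNReal.ofReal ((2 : ℝ) ^ ((n : ℝ) / 2)) * ENNReal.ofReal (3 * Q.len)) := by
          rw [lintegral_indicator measurableSet_Icc, lintegral_const_mul _ hmt]
          gcongr
          exact aux_time _ _ _ hl
      _ = _ := by
          rw [← ENNReal.ofReal_mul hC, ← ENNReal.ofReal_mul (by positivity)]
          congr 1; field_simp
  rw [← ofReal_norm] at main
  exact (ENNReal.ofReal_le_ofReal_iff (by positivity)).1 main
end
end

section
/- Let n ≥ 1 and let W be the heat kernel on ℝ^{n+1}. There is a constant C depending only on n such that the following holds. Let Q ⊂ ℝ^{n+1} be a parabolic cube of side length ℓ(Q) and let g : ℝ^{n+1} → ℝ be a measurable function supported on Q with ‖g‖_∞ ≤ 1/ℓ(Q). Then the convolution W * g(x̄) = ∫ W(x̄ − ȳ) g(ȳ) dm(ȳ) satisfies ‖W * g‖_{Lip_{1/2,t}} ≤ C, i.e. |W*g(x,t) − W*g(x,r)| ≤ C |t−r|^{1/2} for all x ∈ ℝ^n and t, r ∈ ℝ. -/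
open MeasureTheory Real Set

noncomputable section

lemma heatW_pos_eq {n : ℕ} (z : Spc n) {τ : ℝ} (h : 0 < τ) :
    heatW (z, τ) = (4 * π * τ) ^ (-(n : ℝ) / 2) * Real.exp (-(1 / (4 * τ)) * ‖z‖ ^ 2) := by
  unfold heatW
  rw [if_pos h]
  congr 2
  field_simp

lemma heatW_nonpos_eq {n : ℕ} (z : Spc n) {τ : ℝ} (h : τ ≤ 0) : heatW (z, τ) = 0 := by
  unfold heatW
  rw [if_neg (not_lt.mpr h)]

lemma heatW_nonneg' {n : ℕ} (p : Pt n) : 0 ≤ heatW p := by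
  unfold heatW
  split_ifs <;> positivity

lemma measurable_heatW' {n : ℕ} : Measurable (heatW : Pt n → ℝ) := by
  unfold heatW
  refine Measurable.ite (measurableSet_lt measurable_const measurable_snd) ?_ measurable_const
  fun_prop

lemma heatW_integral {n : ℕ} {τ : ℝ} (h : 0 < τ) :
    ∫ z : Spc n, heatW (z, τ) = 1 := by
  simp_rw [heatW_pos_eq _ h]
  rw [integral_const_mul]
  rw [GaussianFourier.integral_rexp_neg_mul_sq_norm (V := Spc n) (by positivity)]
  have : π / (1 / (4 * τ)) = 4 * π * τ := by field_simp
  rw [this, finrank_euclideanSpace, Fintype.card_fin, ← Real.rpow_add (by positivity)]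
  rw [neg_div, neg_add_cancel, Real.rpow_zero]

lemma heatW_integrable {n : ℕ} (τ : ℝ) :
    Integrable (fun z : Spc n => heatW (z, τ)) := by
  rcases lt_or_ge 0 τ with h | h
  · by_contra hc
    have := heatW_integral (n := n) h
    rw [integral_undef hc] at this
    norm_num at this
  · simp_rw [heatW_nonpos_eq _ h]
    exact integrable_zero _ _ _

lemma heatW_integral_le {n : ℕ} (τ : ℝ) :
    ∫ z : Spc n, heatW (z, τ) ≤ 1 := by
  rcases lt_or_ge 0 τ with h | h
  · exact (heatW_integral h).le
  · simp_rw [heatW_nonpos_eq _ h]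
    simp

lemma heatW_mono {n : ℕ} (z : Spc n) {σ τ : ℝ} (hσ : 0 < σ) (h : σ ≤ τ) :
    (σ / τ) ^ ((n : ℝ) / 2) * heatW (z, σ) ≤ heatW (z, τ) := by
  have hτ : 0 < τ := hσ.trans_le h
  rw [heatW_pos_eq _ hσ, heatW_pos_eq _ hτ, ← mul_assoc]
  have e : (σ / τ) ^ ((n : ℝ) / 2) * (4 * π * σ) ^ (-(n : ℝ) / 2)
      = (4 * π * τ) ^ (-(n : ℝ) / 2) := by
    have : σ / τ = (4 * π * σ) / (4 * π * τ) := by field_simp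
    rw [this, Real.div_rpow (by positivity) (by positivity), neg_div,
      Real.rpow_neg (by positivity), Real.rpow_neg (by positivity)]
    have : (4 * π * σ) ^ ((n : ℝ) / 2) ≠ 0 := by positivity
    field_simp
  rw [e]
  gcongr

lemma one_sub_theta {n : ℕ} (hn : 1 ≤ n) {σ τ : ℝ} (hσ : 0 < σ) (h : σ ≤ τ) :
    1 - (σ / τ) ^ ((n : ℝ) / 2) ≤ n * √((τ - σ) / τ) := by
  have hτ : 0 < τ := hσ.trans_le h
  have hx1 : σ / τ ≤ 1 := (div_le_one hτ).2 h
  have hx0 : 0 < σ / τ := by positivity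
  have h1 : (σ / τ) ^ n ≤ (σ / τ) ^ ((n : ℝ) / 2) := by
    rw [← Real.rpow_natCast]
    apply Real.rpow_le_rpow_of_exponent_ge hx0 hx1
    have : (0 : ℝ) ≤ n := by positivity
    linarith
  have h2 := one_add_mul_le_pow (a := σ / τ - 1) (by linarith) n
  rw [add_sub_cancel] at h2
  have e : (τ - σ) / τ = 1 - σ / τ := by field_simp
  rw [e]
  have h3 : 1 - σ / τ ≤ √(1 - σ / τ) := by
    apply Real.le_sqrt_of_sq_le
    nlinarith
  have : (0 : ℝ) ≤ n := by positivity
  nlinarith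

lemma heatW_diff_le {n : ℕ} (hn : 1 ≤ n) {σ τ : ℝ} (h : σ < τ) :
    ∫⁻ z : Spc n, ‖heatW (z, τ) - heatW (z, σ)‖ₑ ≤
      ENNReal.ofReal (2 * n * √(τ - σ) * (√τ)⁻¹) := by
  rcases lt_or_ge 0 τ with hτ | hτ
  swap
  · simp_rw [heatW_nonpos_eq _ hτ, heatW_nonpos_eq _ (h.le.trans hτ)]
    simp
  have e : 2 * n * √(τ - σ) * (√τ)⁻¹ = 2 * (n * √((τ - σ) / τ)) := by
    rw [Real.sqrt_div (by linarith)]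
    ring
  have hd : Integrable (fun z : Spc n => heatW (z, τ) - heatW (z, σ)) :=
    (heatW_integrable τ).sub (heatW_integrable σ)
  rw [e, ← ofReal_integral_norm_eq_lintegral_enorm hd]
  apply ENNReal.ofReal_le_ofReal
  have hn' : (1 : ℝ) ≤ n := by exact_mod_cast hn
  rcases lt_or_ge 0 σ with hσ | hσ
  · set θ := (σ / τ) ^ ((n : ℝ) / 2) with hθ
    have hθ1 : θ ≤ 1 := Real.rpow_le_one (by positivity) ((div_le_one hτ).2 h.le) (by positivity)
    have key : ∀ z : Spc n, ‖heatW (z, τ) - heatW (z, σ)‖ ≤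
        (heatW (z, τ) - θ * heatW (z, σ)) + (1 - θ) * heatW (z, σ) := by
      intro z
      have a := heatW_mono z hσ h.le
      have b := heatW_nonneg' (z, σ)
      rw [← hθ] at a
      have c : 0 ≤ (1 - θ) * heatW (z, σ) := mul_nonneg (by linarith) b
      rw [Real.norm_eq_abs, abs_le]
      constructor <;> nlinarith
    have i1 : Integrable (fun z : Spc n => heatW (z, τ) - θ * heatW (z, σ)) :=
      (heatW_integrable (n := n) τ).sub ((heatW_integrable (n := n) σ).const_mul θ)
    have i2 := (heatW_integrable (n := n) σ).const_mul (1 - θ)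
    calc _ ≤ ∫ z : Spc n, ((heatW (z, τ) - θ * heatW (z, σ)) + (1 - θ) * heatW (z, σ)) :=
          integral_mono ((heatW_integrable τ).sub (heatW_integrable σ)).norm (i1.add i2) key
      _ = (1 - θ) + (1 - θ) := by
          rw [integral_add i1 i2, integral_sub (heatW_integrable τ)
            ((heatW_integrable σ).const_mul θ), integral_const_mul, integral_const_mul,
            heatW_integral hτ, heatW_integral hσ]
          ring
      _ ≤ _ := by
          have := one_sub_theta hn hσ h.le
          linarith
  · simp_rw [heatW_nonpos_eq _ hσ, sub_zero, Real.norm_eq_abs, abs_of_nonneg (heatW_nonneg' _)]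
    rw [heatW_integral hτ]
    have : 1 ≤ √((τ - σ) / τ) := by
      rw [Real.one_le_sqrt, one_le_div hτ]
      linarith
    nlinarith

lemma time_lintegral (t a : ℝ) {ℓ : ℝ} (hl : 0 < ℓ) :
    ∫⁻ s in Icc a (a + ℓ ^ 2), ENNReal.ofReal ((√(t - s))⁻¹) ≤ ENNReal.ofReal (3 * ℓ) := by
  have key : ∀ s, ENNReal.ofReal ((√(t - s))⁻¹) ≤
      (Ioo 0 (ℓ ^ 2)).indicator (fun τ : ℝ => ENNReal.ofReal (τ ^ (-(1 / 2) : ℝ))) (t - s)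
        + ENNReal.ofReal ℓ⁻¹ := by
    intro s
    by_cases h : t - s ∈ Ioo 0 (ℓ ^ 2)
    · rw [indicator_of_mem h, Real.rpow_neg h.1.le, ← Real.sqrt_eq_rpow]
      exact le_self_add
    · rw [indicator_of_notMem h, zero_add]
      apply ENNReal.ofReal_le_ofReal
      rcases le_or_gt (t - s) 0 with h0 | h0
      · rw [Real.sqrt_eq_zero_of_nonpos h0]
        simp [hl.le]
      · have : ℓ ^ 2 ≤ t - s := by
          by_contra hc
          exact h ⟨h0, not_le.1 hc⟩
        apply inv_anti₀ hl
        exact Real.le_sqrt_of_sq_le this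
  have i1 : ∫⁻ τ in Ioo 0 (ℓ ^ 2), ENNReal.ofReal (τ ^ (-(1 / 2) : ℝ)) = ENNReal.ofReal (2 * ℓ) := by
    have hi : IntervalIntegrable (fun τ : ℝ => τ ^ (-(1 / 2) : ℝ)) volume 0 (ℓ ^ 2) :=
      intervalIntegral.intervalIntegrable_rpow' (by norm_num)
    have hv := integral_rpow (a := 0) (b := ℓ ^ 2) (r := (-(1 / 2) : ℝ)) (Or.inl (by norm_num))
    rw [intervalIntegrable_iff_integrableOn_Ioo_of_le (by positivity)] at hi
    rw [← ofReal_integral_eq_lintegral_ofReal hi]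
    · congr 1
      rw [← integral_Ioc_eq_integral_Ioo, ← intervalIntegral.integral_of_le (by positivity), hv]
      have : (-(1 / 2) + 1 : ℝ) = 1 / 2 := by norm_num
      rw [this, ← Real.sqrt_eq_rpow, ← Real.sqrt_eq_rpow, Real.sqrt_sq hl.le]
      simp
      ring
    · filter_upwards [ae_restrict_mem measurableSet_Ioo] with τ hτ
      exact Real.rpow_nonneg hτ.1.le _
  calc _ ≤ ∫⁻ s in Icc a (a + ℓ ^ 2), ((Ioo 0 (ℓ ^ 2)).indicator
        (fun τ : ℝ => ENNReal.ofReal (τ ^ (-(1 / 2) : ℝ))) (t - s) + ENNReal.ofReal ℓ⁻¹) :=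
        lintegral_mono key
    _ = (∫⁻ s in Icc a (a + ℓ ^ 2), (Ioo 0 (ℓ ^ 2)).indicator
        (fun τ : ℝ => ENNReal.ofReal (τ ^ (-(1 / 2) : ℝ))) (t - s)) + ENNReal.ofReal ℓ := by
        rw [lintegral_add_right _ measurable_const]
        congr 1
        rw [setLIntegral_const, Real.volume_Icc, ← ENNReal.ofReal_mul (by positivity)]
        congr 1
        field_simp
        ring
    _ ≤ (∫⁻ s, (Ioo 0 (ℓ ^ 2)).indicator
        (fun τ : ℝ => ENNReal.ofReal (τ ^ (-(1 / 2) : ℝ))) (t - s)) + ENNReal.ofReal ℓ := by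
        gcongr
        exact Measure.restrict_le_self
    _ = ENNReal.ofReal (2 * ℓ) + ENNReal.ofReal ℓ := by
        rw [lintegral_sub_left_eq_self (fun s => (Ioo 0 (ℓ ^ 2)).indicator
          (fun τ : ℝ => ENNReal.ofReal (τ ^ (-(1 / 2) : ℝ))) s) t,
          lintegral_indicator measurableSet_Ioo, i1]
    _ = _ := by
        rw [← ENNReal.ofReal_add (by positivity) hl.le]
        congr 1
        ring

/-- Generic bound through Fubini. -/
lemma fubini_bound {n : ℕ} (Q : PCube n) (g : Pt n → ℝ)
    (hs : Function.support g ⊆ Q.toSet) (hb : ∀ y, |g y| ≤ 1 / Q.len)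
    (k : Pt n → ℝ) (hk : Measurable k) (x : Spc n) (t : ℝ) (B : ℝ → ENNReal)
    (hB : ∀ s, ∫⁻ z : Spc n, ‖k (z, t - s)‖ₑ ≤ B s) :
    ∫⁻ y, ‖g y * k ((x, t) - y)‖ₑ ≤
      ENNReal.ofReal (1 / Q.len) * ∫⁻ s in Icc Q.time (Q.time + Q.len ^ 2), B s := by
  have hl := Q.len_pos
  set I := Icc Q.time (Q.time + Q.len ^ 2) with hI
  have pw : ∀ y : Pt n, ‖g y * k ((x, t) - y)‖ₑ ≤
      ENNReal.ofReal (1 / Q.len) * I.indicator (fun _ => ‖k ((x, t) - y)‖ₑ) y.2 := by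
    intro y
    by_cases hy : g y = 0
    · simp [hy]
    · have : y.2 ∈ I := (hs hy).2
      rw [indicator_of_mem this, enorm_mul]
      gcongr
      rw [← ofReal_norm]
      exact ENNReal.ofReal_le_ofReal (hb y)
  have hm : Measurable (fun y : Pt n => I.indicator (fun _ => ‖k ((x, t) - y)‖ₑ) y.2) := by
    have : (fun y : Pt n => I.indicator (fun _ => ‖k ((x, t) - y)‖ₑ) y.2) =
        (Prod.snd ⁻¹' I).indicator (fun y : Pt n => ‖k ((x, t) - y)‖ₑ) := by
      ext y
      simp [indicator]
    rw [this]
    exact (hk.comp (measurable_const.sub measurable_id)).enorm.indicator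
      (measurable_snd measurableSet_Icc)
  calc _ ≤ ∫⁻ y : Pt n, ENNReal.ofReal (1 / Q.len) *
        I.indicator (fun _ => ‖k ((x, t) - y)‖ₑ) y.2 := lintegral_mono pw
    _ = ENNReal.ofReal (1 / Q.len) * ∫⁻ y : Pt n,
        I.indicator (fun _ => ‖k ((x, t) - y)‖ₑ) y.2 := lintegral_const_mul _ hm
    _ ≤ _ := by
        gcongr
        rw [Measure.volume_eq_prod, lintegral_prod_symm _ hm.aemeasurable,
          ← lintegral_indicator measurableSet_Icc]
        apply lintegral_mono
        intro s
        by_cases h : s ∈ I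
        · simp only [indicator_of_mem h, Prod.mk_sub_mk]
          rw [lintegral_sub_left_eq_self (fun z : Spc n => ‖k (z, t - s)‖ₑ) x]
          rw [← hI, indicator_of_mem h]
          exact hB s
        · simp [indicator_of_notMem h]

theorem heatW_conv_fun_lipHalf (n : ℕ) (hn : 1 ≤ n) :
    ∃ C : ℝ, 0 < C ∧ ∀ (Q : PCube n) (g : Pt n → ℝ), Measurable g →
      Function.support g ⊆ Q.toSet → (∀ y, |g y| ≤ 1 / Q.len) →
      LipHalfLe (fun p : Pt n => ∫ y, g y * heatW (p - y)) C := by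
  have hn' : (1 : ℝ) ≤ n := by exact_mod_cast hn
  refine ⟨6 * n, by positivity, ?_⟩
  intro Q g hg hs hb x
  have hl := Q.len_pos
  have hint : ∀ t : ℝ, Integrable (fun y : Pt n => g y * heatW ((x, t) - y)) := by
    intro t
    refine ⟨(hg.mul (measurable_heatW'.comp
      (measurable_const.sub measurable_id))).aestronglyMeasurable, ?_⟩
    refine lt_of_le_of_lt (fubini_bound Q g hs hb heatW measurable_heatW' x t (fun _ => 1) ?_) ?_
    · intro s
      rw [← ofReal_integral_norm_eq_lintegral_enorm (heatW_integrable _)]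
      simp_rw [Real.norm_eq_abs, abs_of_nonneg (heatW_nonneg' _)]
      rw [← ENNReal.ofReal_one]
      exact ENNReal.ofReal_le_ofReal (heatW_integral_le _)
    · rw [setLIntegral_const, Real.volume_Icc, one_mul]
      exact ENNReal.mul_lt_top ENNReal.ofReal_lt_top ENNReal.ofReal_lt_top
  have main : ∀ t u : ℝ, u < t → |(∫ y, g y * heatW ((x, t) - y)) -
      ∫ y, g y * heatW ((x, u) - y)| ≤ 6 * n * √|t - u| := by
    intro t u h
    rw [abs_of_pos (sub_pos.2 h), ← integral_sub (hint t) (hint u), ← Real.norm_eq_abs]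
    have e : ∀ y : Pt n, g y * heatW ((x, t) - y) - g y * heatW ((x, u) - y) =
        g y * (fun p : Pt n => heatW p - heatW (p.1, p.2 - (t - u))) ((x, t) - y) := by
      intro y
      have : ((x, u) : Pt n) - y = (x - y.1, t - y.2 - (t - u)) := by
        ext <;> simp
      simp only [this, Prod.fst_sub, Prod.snd_sub]
      ring
    simp_rw [e]
    have hh : 0 < t - u := sub_pos.2 h
    have hk : Measurable (fun p : Pt n => heatW p - heatW (p.1, p.2 - (t - u))) :=
      measurable_heatW'.sub (measurable_heatW'.comp
        (measurable_fst.prodMk (measurable_snd.sub measurable_const)))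
    have fb := fubini_bound Q g hs hb _ hk x t
      (fun s => ENNReal.ofReal (2 * n * √(t - u)) * ENNReal.ofReal ((√(t - s))⁻¹)) (by
        intro s
        have := heatW_diff_le hn (σ := t - s - (t - u)) (τ := t - s) (by linarith)
        rw [sub_sub_cancel] at this
        rw [← ENNReal.ofReal_mul (by positivity)]
        exact this)
    rw [lintegral_const_mul' _ _ ENNReal.ofReal_ne_top] at fb
    have fin : ENNReal.ofReal (1 / Q.len) * (ENNReal.ofReal (2 * n * √(t - u)) *
        ∫⁻ s in Icc Q.time (Q.time + Q.len ^ 2), ENNReal.ofReal ((√(t - s))⁻¹)) ≤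
        ENNReal.ofReal (6 * n * √(t - u)) := by
      calc _ ≤ ENNReal.ofReal (1 / Q.len) * (ENNReal.ofReal (2 * n * √(t - u)) *
            ENNReal.ofReal (3 * Q.len)) := by
            gcongr
            exact time_lintegral t Q.time hl
        _ = _ := by
            rw [← ENNReal.ofReal_mul (by positivity), ← ENNReal.ofReal_mul (by positivity)]
            congr 1
            field_simp
            ring
    have := (enorm_integral_le_lintegral_enorm _).trans (fb.trans fin)
    rw [← ofReal_norm] at this
    exact (ENNReal.ofReal_le_ofReal_iff (by positivity)).1 this
  intro t u
  rcases lt_trichotomy u t with h | h | h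
  · exact main t u h
  · subst h
    simp
  · rw [abs_sub_comm, abs_sub_comm t u]
    exact main u t h
end
end
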